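/- arXiv:2409.02940 — 2 statements merged into one kernel-verified Lean document; each statement's English description precedes it below -/
import Mathlib

section
/- Fix integers r ≥ 2 and n ≥ 1. Let z = Σ_{j=1}^r c_j·x̂_j be a cycle of exterior degree 1 in K(𝔉; x_1 − y_1, …, x_r − y_r) whose image in K(ℚ ⊗ 𝔉; x_1 − y_1, …, x_r − y_r) is homologous to κ_n := (1/(n+1))·Σ_{j=1}^r (Σ_{i=0}^n x_j^i·y_j^{n−i})·x̂_j. Let J = (i_1, …, i_l) be any sequence with each i_t ∈ {1, …, r−1}, let H_q denote the Koszul homology of K(R_J; x_1 − y_1, …, x_r − y_r), and let Φ(z) := Σ_{j=1}^r φ_J(c_j)·x̂_j where φ_J : 𝔉 → R_J is the ring homomorphism with x_i ↦ x_i, y_i ↦ y_i. Then the quotient N := H_r / (image of multiplication by the class of Φ(z) : H_{r−1} → H_r) is a free abelian group, and x_i^n·N = 0 for every i = 1, …, r; i.e. the ℤ[x_1, …, x_r]-module structure on N factors through ℤ[x_1, …, x_r]/(x_1^n, …, x_r^n). -/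
noncomputable section
open MvPolynomial

/-- The `k`-th elementary symmetric function of a finite family of ring elements:
`e_k(v) = Σ_{S ⊆ ι, |S| = k} Π_{j ∈ S} v j`. -/
def esym {R : Type*} [CommRing R] {ι : Type*} [Fintype ι] [DecidableEq ι]
    (k : ℕ) (v : ι → R) : R :=
  ∑ S ∈ Finset.univ.powersetCard k, ∏ j ∈ S, v j

/-- The polynomial ring `ℤ[x_1,…,x_r,y_1,…,y_r]`: `Sum.inl` indexes the `x`'s and
`Sum.inr` indexes the `y`'s. -/
abbrev FPoly (r : ℕ) := MvPolynomial (Fin r ⊕ Fin r) ℤ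

/-- The relation `e_{j+1}(x) − e_{j+1}(y)` (so the degrees `1,…,r` occur as `j` runs
through `Fin r`). -/
def Frel (r : ℕ) (j : Fin r) : FPoly r :=
  esym ((j : ℕ) + 1) (fun i : Fin r => (X (Sum.inl i) : FPoly r)) -
    esym ((j : ℕ) + 1) (fun i : Fin r => (X (Sum.inr i) : FPoly r))

/-- The ring `𝔉 = ℤ[x,y]/(e_1(x) − e_1(y), …, e_r(x) − e_r(y))`. -/
abbrev FRing (r : ℕ) := FPoly r ⧸ Ideal.span (Set.range (Frel r))

/-- The rational version `ℚ ⊗ 𝔉`: the polynomial ring `ℚ[x,y]` modulo the images of the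
relations `e_j(x) − e_j(y)`. -/
abbrev FQRing (r : ℕ) :=
  MvPolynomial (Fin r ⊕ Fin r) ℚ ⧸
    Ideal.span (Set.range fun j => MvPolynomial.map (Int.castRingHom ℚ) (Frel r j))

/-- The canonical ring homomorphism `𝔉 → ℚ ⊗ 𝔉` at the level of representatives:
`ℤ[x,y] → ℚ ⊗ 𝔉`. -/
def toFQ (r : ℕ) : FPoly r →+* FQRing r :=
  (Ideal.Quotient.mk _).comp (MvPolynomial.map (Int.castRingHom ℚ))

/-- `x_j` in `𝔉`. -/
def xZ (r : ℕ) (j : Fin r) : FRing r := Ideal.Quotient.mk _ (X (Sum.inl j))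

/-- `y_j` in `𝔉`. -/
def yZ (r : ℕ) (j : Fin r) : FRing r := Ideal.Quotient.mk _ (X (Sum.inr j))

/-- `x_j` in `ℚ ⊗ 𝔉`. -/
def xQ (r : ℕ) (j : Fin r) : FQRing r := toFQ r (X (Sum.inl j))

/-- `y_j` in `ℚ ⊗ 𝔉`. -/
def yQ (r : ℕ) (j : Fin r) : FQRing r := toFQ r (X (Sum.inr j))

/-- The `j`-th coefficient of `κ_n = (1/(n+1))·Σ_j (Σ_{i=0}^n x_j^i·y_j^{n−i})·x̂_j`. -/
def kappa (r n : ℕ) (j : Fin r) : FQRing r :=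
  algebraMap ℚ (FQRing r) (1 / (n + 1)) *
    ∑ i ∈ Finset.range (n + 1), xQ r j ^ i * yQ r j ^ (n - i)


/-- The polynomial ring `ℤ[x_1,…,x_r,δ_1,…,δ_l]` with `r = m + 2` strands:
`Sum.inl` indexes the `x`'s and `Sum.inr` indexes the `δ`'s. -/
abbrev BSPoly (m l : ℕ) := MvPolynomial (Fin (m + 2) ⊕ Fin l) ℤ

/-- The Bott–Samelson relation attached to `t`:
`δ_t·(δ_t + x_{i_t} − x_{i_t+1} + 2·Σ_{s<t, i_s=i_t} δ_s − Σ_{s<t, |i_s−i_t|=1} δ_s)`.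
Crossing indices are zero-based: `i t : Fin (m+1)` encodes the simple reflection between
strands `i t` and `i t + 1` (zero-based), so `x_{i_t} = X (Sum.inl (i t).castSucc)` and
`x_{i_t+1} = X (Sum.inl (i t).succ)`. -/
def BSrel (m l : ℕ) (i : Fin l → Fin (m + 1)) (t : Fin l) : BSPoly m l :=
  X (Sum.inr t) *
    (X (Sum.inr t) + X (Sum.inl (i t).castSucc) - X (Sum.inl (i t).succ)
      + 2 * ∑ s ∈ Finset.univ.filter fun s => s < t ∧ i s = i t, X (Sum.inr s)
      - ∑ s ∈ Finset.univ.filter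
          fun s => s < t ∧ ((i s : ℕ) = (i t : ℕ) + 1 ∨ (i t : ℕ) = (i s : ℕ) + 1),
          X (Sum.inr s))

/-- The Bott–Samelson ring `R_J = ℤ[x,δ]/I_J`. -/
abbrev BSRing (m l : ℕ) (i : Fin l → Fin (m + 1)) :=
  BSPoly m l ⧸ Ideal.span (Set.range (BSrel m l i))

/-- `x_j ∈ R_J`. -/
def xB (m l : ℕ) (i : Fin l → Fin (m + 1)) (j : Fin (m + 2)) : BSRing m l i :=
  Ideal.Quotient.mk _ (X (Sum.inl j))

/-- `δ_t ∈ R_J`. -/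
def δB (m l : ℕ) (i : Fin l → Fin (m + 1)) (t : Fin l) : BSRing m l i :=
  Ideal.Quotient.mk _ (X (Sum.inr t))

/-- `δ̂_c = Σ_{t : i_t = c} δ_t ∈ R_J`, indexed by an integer `c` so that the conventions
`δ̂_0 = δ̂_r = 0` (one-based) hold automatically. -/
def δhat (m l : ℕ) (i : Fin l → Fin (m + 1)) (c : ℤ) : BSRing m l i :=
  ∑ t ∈ Finset.univ.filter fun t => ((i t : ℕ) : ℤ) = c, δB m l i t

/-- `y_j = x_j + δ̂_j − δ̂_{j−1} ∈ R_J` (zero-based `j`). -/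
def yB (m l : ℕ) (i : Fin l → Fin (m + 1)) (j : Fin (m + 2)) : BSRing m l i :=
  xB m l i j + δhat m l i (j : ℤ) - δhat m l i ((j : ℤ) - 1)

/-- The ring homomorphism `ℤ[x_1,…,x_r,y_1,…,y_r] → R_J`, `x_j ↦ x_j`, `y_j ↦ y_j`. -/
def toBS (m l : ℕ) (i : Fin l → Fin (m + 1)) :
    MvPolynomial (Fin (m + 2) ⊕ Fin (m + 2)) ℤ →+* BSRing m l i :=
  (MvPolynomial.aeval fun v => Sum.elim (xB m l i) (yB m l i) v).toRingHom

/-- The ring homomorphism `ℤ[x_1,…,x_r] → R_J`, `x_j ↦ x_j`. -/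
def ψBS (m l : ℕ) (i : Fin l → Fin (m + 1)) :
    MvPolynomial (Fin (m + 2)) ℤ →+* BSRing m l i :=
  (MvPolynomial.aeval fun j => xB m l i j).toRingHom


/-- The underlying module of the Koszul complex `B ⊗ Λ(x̂_1,…,x̂_r)`: a free `B`-module
with basis the square-free monomials `x̂_S = x̂_{s_1}∧⋯∧x̂_{s_q}` (`s_1 < ⋯ < s_q`)
indexed by finsets `S ⊆ Fin r`. -/
abbrev KModule (B : Type*) [CommRing B] (r : ℕ) := Finset (Fin r) → B

/-- The Koszul sign `(−1)^{#{j ∈ t | j < i}}` arising when moving `x̂_i` past the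
generators of `x̂_t` that precede it. -/
def ksign {B : Type*} [CommRing B] {r : ℕ} (i : Fin r) (t : Finset (Fin r)) : B :=
  (-1) ^ (t.filter fun j => j < i).card

/-- The Koszul differential of `K(B; z_1,…,z_r)`: the `B`-linear map of exterior
degree `−1` determined by the graded Leibniz rule and `d(x̂_i) = z i`; on basis
elements, `d(x̂_S) = Σ_{i ∈ S} ±(z i)·x̂_{S∖i}`. -/
def koszulD {B : Type*} [CommRing B] {r : ℕ} (z : Fin r → B) :
    KModule B r →ₗ[B] KModule B r where
  toFun f t := ∑ i ∈ tᶜ, ksign i t * z i * f (insert i t)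
  map_add' f g := by
    funext t
    simp [Pi.add_apply, mul_add, Finset.sum_add_distrib]
  map_smul' c f := by
    funext t
    simp only [Pi.smul_apply, smul_eq_mul, RingHom.id_apply, Finset.mul_sum]
    exact Finset.sum_congr rfl fun i _ => by ring

/-- Left exterior multiplication by the degree-1 element `Σ_i (c i)·x̂_i`: the
`B`-linear map of exterior degree `+1` with `x̂_S ↦ Σ_{i ∉ S} ±(c i)·x̂_{S∪i}`. -/
def extMul {B : Type*} [CommRing B] {r : ℕ} (c : Fin r → B) :
    KModule B r →ₗ[B] KModule B r where
  toFun f t := ∑ i ∈ t, ksign i (t.erase i) * c i * f (t.erase i)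
  map_add' f g := by
    funext t
    simp [Pi.add_apply, mul_add, Finset.sum_add_distrib]
  map_smul' a f := by
    funext t
    simp only [Pi.smul_apply, smul_eq_mul, RingHom.id_apply, Finset.mul_sum]
    exact Finset.sum_congr rfl fun i _ => by ring

/-- The exterior-degree-`q` summand of the Koszul complex (indexed by `q : ℤ`, so
negative degrees vanish automatically). -/
def kdeg (B : Type*) [CommRing B] (r : ℕ) (q : ℤ) : Submodule B (KModule B r) where
  carrier := {f | ∀ s : Finset (Fin r), (s.card : ℤ) ≠ q → f s = 0}
  add_mem' := by
    intro f g hf hg s hs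
    simp [Pi.add_apply, hf s hs, hg s hs]
  zero_mem' := by intro s _; rfl
  smul_mem' := by
    intro c f hf s hs
    simp [Pi.smul_apply, hf s hs]

/-- Degree-`q` cycles of the Koszul complex `K(B; z)`. -/
def kcycles {B : Type*} [CommRing B] {r : ℕ} (z : Fin r → B) (q : ℤ) :
    Submodule B (KModule B r) :=
  kdeg B r q ⊓ LinearMap.ker (koszulD z)

/-- Degree-`q` boundaries of the Koszul complex `K(B; z)`. -/
def kbdries {B : Type*} [CommRing B] {r : ℕ} (z : Fin r → B) (q : ℤ) :
    Submodule B (KModule B r) :=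
  Submodule.map (koszulD z) (kdeg B r (q + 1))

/-- The degree-`q` Koszul homology `H_q` of `K(B; z)`. -/
abbrev KH {B : Type*} [CommRing B] {r : ℕ} (z : Fin r → B) (q : ℤ) :=
  kcycles z q ⧸ (kbdries z q).comap (kcycles z q).subtype

/-- An additive map `D : ℤ[X] → R` is a biderivation along `a, b : ι → R` if
`D (f g) = f(a) D(g) + D(f) g(b)`. -/
def IsBider {ι R : Type*} [CommRing R] (a b : ι → R) (D : MvPolynomial ι ℤ →+ R) : Prop :=
  ∀ f g, D (f * g) = aeval a f * D g + D f * aeval b g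

/-- The compatibility satisfied by the values of a biderivation on the variables. -/
def IsKCocycle {ι R : Type*} [CommRing R] (a b f : ι → R) : Prop :=
  ∀ j k, f j * (a k - b k) = f k * (a j - b j)

section Bider

variable {ι R : Type*} [CommRing R] {a b : ι → R} {D E : MvPolynomial ι ℤ →+ R}

lemma IsBider.swap (h : IsBider a b D) : IsBider b a D := by
  intro f g
  rw [mul_comm f g, h g f]
  ring

lemma IsBider.map_one (h : IsBider a b D) : D 1 = 0 := by
  have := h 1 1
  simpa using this

lemma IsBider.map_C (h : IsBider a b D) (c : ℤ) : D (C c) = 0 := by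
  have : (C c : MvPolynomial ι ℤ) = c • 1 := by simp
  rw [this, map_zsmul, h.map_one, smul_zero]

lemma IsBider.isKCocycle (h : IsBider a b D) : IsKCocycle a b fun j => D (X j) := by
  intro j k
  have h1 := h (X j) (X k)
  have h2 := h (X k) (X j)
  rw [mul_comm (X k) (X j), h1] at h2
  simp only [aeval_X] at h2
  linear_combination -h2

lemma IsBider.ext (hD : IsBider a b D) (hE : IsBider a b E)
    (h : ∀ j, D (X j) = E (X j)) (f : MvPolynomial ι ℤ) : D f = E f := by
  induction f using MvPolynomial.induction_on with
  | C c => rw [hD.map_C, hE.map_C]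
  | add p q hp hq => rw [map_add, map_add, hp, hq]
  | mul_X p j hp => rw [hD, hE, hp, h]

lemma IsBider.add (hD : IsBider a b D) (hE : IsBider a b E) : IsBider a b (D + E) := by
  intro f g
  simp only [AddMonoidHom.add_apply, hD f g, hE f g]
  ring

lemma IsBider.mulLeft (hD : IsBider a b D) (r : R) :
    IsBider a b ((AddMonoidHom.mulLeft r).comp D) := by
  intro f g
  simp only [AddMonoidHom.comp_apply, AddMonoidHom.coe_mulLeft, hD f g]
  ring

lemma IsBider.comp (hD : IsBider a b D) {κ : Type*} (σ : κ → MvPolynomial ι ℤ) :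
    IsBider (fun k => aeval a (σ k)) (fun k => aeval b (σ k))
      (D.comp (aeval σ : MvPolynomial κ ℤ →ₐ[ℤ] MvPolynomial ι ℤ).toRingHom.toAddMonoidHom) := by
  have key : ∀ (c : ι → R) (f : MvPolynomial κ ℤ),
      aeval c (aeval σ f) = aeval (fun k => aeval c (σ k)) f := by
    intro c f
    rw [← AlgHom.comp_apply, comp_aeval]
  intro f g
  simp only [AddMonoidHom.comp_apply, RingHom.toAddMonoidHom_eq_coe, AddMonoidHom.coe_coe,
    AlgHom.toRingHom_eq_coe, RingHom.coe_coe, map_mul, hD (aeval σ f) (aeval σ g), key]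

lemma IsBider.map_X_pow (h : IsBider a b D) (j : ι) (k : ℕ) :
    D (X j ^ (k + 1)) = D (X j) * ∑ i ∈ Finset.range (k + 1), a j ^ i * b j ^ (k - i) := by
  induction k with
  | zero => simp
  | succ k ih =>
    rw [pow_succ' (X j) (k + 1), h, ih, Finset.sum_range_succ' _ (k + 1)]
    have : ∀ i ∈ Finset.range (k + 1), a j ^ (i + 1) * b j ^ (k + 1 - (i + 1))
        = a j * (a j ^ i * b j ^ (k - i)) := by
      intro i _
      rw [Nat.add_sub_add_right]
      ring
    rw [Finset.sum_congr rfl this, ← Finset.mul_sum]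
    simp only [aeval_X, map_pow, pow_zero, one_mul, Nat.sub_zero]
    ring

lemma IsBider.central {f : MvPolynomial ι ℤ} (h : IsBider a b D)
    (hf : aeval a f = aeval b f) (j : ι) : a j * D f = b j * D f := by
  have h1 := h (X j) f
  have h2 := h f (X j)
  rw [mul_comm f, h1, hf] at h2
  simp only [aeval_X] at h2
  linear_combination h2

open scoped IsMulCommutative in
lemma IsKCocycle.exists_isBider {f : ι → R} (hf : IsKCocycle a b f) :
    ∃ D : MvPolynomial ι ℤ →+ R, IsBider a b D ∧ ∀ j, D (X j) = f j := by
  classical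
  let M : ι → Matrix (Fin 2) (Fin 2) R := fun j => !![a j, f j; 0, b j]
  have hcomm : ∀ P ∈ Set.range M, ∀ Q ∈ Set.range M, P * Q = Q * P := by
    rintro _ ⟨j, rfl⟩ _ ⟨k, rfl⟩
    have := hf j k
    ext u v
    fin_cases u <;> fin_cases v <;> simp [M, Matrix.mul_apply, Fin.sum_univ_two, mul_comm]
    linear_combination -this
  have := Algebra.isMulCommutative_adjoin ℤ hcomm
  let F : MvPolynomial ι ℤ →ₐ[ℤ] Algebra.adjoin ℤ (Set.range M) :=
    aeval fun j => ⟨M j, Algebra.subset_adjoin ⟨j, rfl⟩⟩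
  have hX : ∀ j, (F (X j) : Matrix (Fin 2) (Fin 2) R) = M j := by
    intro j
    simp [F]
  have hF : ∀ p, (F p : Matrix (Fin 2) (Fin 2) R) 0 0 = aeval a p ∧
      (F p : Matrix (Fin 2) (Fin 2) R) 1 0 = 0 ∧
      (F p : Matrix (Fin 2) (Fin 2) R) 1 1 = aeval b p := by
    intro p
    induction p using MvPolynomial.induction_on with
    | C c =>
      have : (F (C c) : Matrix (Fin 2) (Fin 2) R) = algebraMap ℤ _ c := by
        rw [← MvPolynomial.algebraMap_eq, AlgHom.commutes]
        rfl
      rw [this]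
      simp [Matrix.algebraMap_matrix_apply]
    | add p q hp hq =>
      simp [hp, hq]
    | mul_X p j hp =>
      have : (F (p * X j) : Matrix (Fin 2) (Fin 2) R) = F p * M j := by
        rw [map_mul, ← hX]; rfl
      rw [this]
      simp [Matrix.mul_apply, Fin.sum_univ_two, hp, M]
  refine ⟨{ toFun := fun p => (F p : Matrix (Fin 2) (Fin 2) R) 0 1
            map_zero' := by rw [map_zero]; rfl
            map_add' := fun p q => by rw [map_add]; rfl }, ?_, ?_⟩
  · intro p q
    have : (F (p * q) : Matrix (Fin 2) (Fin 2) R) = F p * F q := by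
      rw [map_mul]; rfl
    change (F (p * q) : Matrix (Fin 2) (Fin 2) R) 0 1 = _ * (F q : Matrix (Fin 2) (Fin 2) R) 0 1
      + (F p : Matrix (Fin 2) (Fin 2) R) 0 1 * _
    rw [this]
    simp [Matrix.mul_apply, Fin.sum_univ_two, hF]
  · intro j
    change (F (X j) : Matrix (Fin 2) (Fin 2) R) 0 1 = f j
    rw [hX]
    simp [M]

end Bider


/-- The ideal annihilated by all `a j - b j`. -/
def centralIdeal {ι R : Type*} [CommRing R] (a b : ι → R) : Ideal R where
  carrier := {v | ∀ j, a j * v = b j * v}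
  add_mem' := fun hu hv j => by rw [mul_add, mul_add, hu j, hv j]
  zero_mem' := fun j => by simp
  smul_mem' := fun c v hv j => by
    rw [smul_eq_mul, mul_left_comm, hv j, mul_left_comm]

lemma mem_centralIdeal {ι R : Type*} [CommRing R] {a b : ι → R} {v : R} :
    v ∈ centralIdeal a b ↔ ∀ j, a j * v = b j * v := Iff.rfl

/-- The central elements `v` such that `N v` is the value at `p` of a biderivation. -/
def biderIdeal {ι R : Type*} [CommRing R] (a b : ι → R) (p : MvPolynomial ι ℤ) (N : ℕ) :
    Ideal R where
  carrier := {v | v ∈ centralIdeal a b ∧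
    ∃ D : MvPolynomial ι ℤ →+ R, IsBider a b D ∧ (N : R) * v = D p}
  add_mem' := by
    rintro u v ⟨hu, D, hD, hDu⟩ ⟨hv, E, hE, hEv⟩
    exact ⟨add_mem hu hv, D + E, hD.add hE, by rw [mul_add, hDu, hEv]; rfl⟩
  zero_mem' := ⟨zero_mem _, 0, fun _ _ => by simp, by simp⟩
  smul_mem' := by
    rintro c v ⟨hv, D, hD, hDv⟩
    refine ⟨Ideal.mul_mem_left _ c hv, _, hD.mulLeft c, ?_⟩
    rw [smul_eq_mul, mul_left_comm, hDv]
    rfl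

lemma mem_biderIdeal {ι R : Type*} [CommRing R] {a b : ι → R} {p : MvPolynomial ι ℤ} {N : ℕ}
    {v : R} : v ∈ biderIdeal a b p N ↔ v ∈ centralIdeal a b ∧
      ∃ D : MvPolynomial ι ℤ →+ R, IsBider a b D ∧ (N : R) * v = D p := Iff.rfl

/-- The quotient of the central ideal by the ideal of values of biderivations at `p`
embeds in a free abelian group. -/
def NFree {ι R : Type} [CommRing R] (a b : ι → R) (p : MvPolynomial ι ℤ) (N : ℕ) : Prop :=
  ∃ (L : Type) (_ : AddCommGroup L) (_ : Module.Free ℤ L) (g : centralIdeal a b →+ L),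
    ∀ v, g v = 0 ↔ (v : R) ∈ biderIdeal a b p N

section NFree

variable {ι κ R S T : Type} [CommRing R] [CommRing S] [CommRing T] {a b : ι → R}
  {a' b' : κ → S} {a'' b'' : κ → T}
  {p : MvPolynomial ι ℤ} {q : MvPolynomial κ ℤ} {N : ℕ}

lemma centralIdeal_swap : centralIdeal a b = centralIdeal b a :=
  Ideal.ext fun _ => forall_congr' fun _ => eq_comm

lemma biderIdeal_swap : biderIdeal a b p N = biderIdeal b a p N := by
  ext v
  rw [mem_biderIdeal, mem_biderIdeal, centralIdeal_swap]
  exact and_congr_right fun _ => exists_congr fun D =>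
    and_congr_left fun _ => ⟨IsBider.swap, IsBider.swap⟩

lemma NFree.swap (h : NFree a b p N) : NFree b a p N := by
  rw [NFree, centralIdeal_swap, biderIdeal_swap]
  exact h

/-- `NFree` is reflected by pairs of additive maps which jointly detect the ideals. -/
lemma NFree.of_pair (h' : NFree a' b' q N) (h'' : NFree a'' b'' q N) (φ : R →+ S) (ψ : R →+ T)
    (hφ : ∀ v ∈ centralIdeal a b, φ v ∈ centralIdeal a' b')
    (hψ : ∀ v ∈ centralIdeal a b, ψ v ∈ centralIdeal a'' b'')
    (hB : ∀ v ∈ centralIdeal a b, v ∈ biderIdeal a b p N ↔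
      φ v ∈ biderIdeal a' b' q N ∧ ψ v ∈ biderIdeal a'' b'' q N) : NFree a b p N := by
  obtain ⟨L', _, _, g', hg'⟩ := h'
  obtain ⟨L'', _, _, g'', hg''⟩ := h''
  refine ⟨L' × L'', inferInstance, inferInstance,
    { toFun := fun v => (g' ⟨φ v, hφ v v.2⟩, g'' ⟨ψ v, hψ v v.2⟩)
      map_zero' := ?_
      map_add' := ?_ }, ?_⟩
  · have h1 : (⟨φ (0 : centralIdeal a b), hφ _ (zero_mem _)⟩ : centralIdeal a' b') = 0 := by
      ext; simp
    have h2 : (⟨ψ (0 : centralIdeal a b), hψ _ (zero_mem _)⟩ : centralIdeal a'' b'') = 0 := by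
      ext; simp
    rw [h1, h2, map_zero, map_zero]; rfl
  · intro u v
    have h1 : (⟨φ (u + v : centralIdeal a b), hφ _ (u + v).2⟩ : centralIdeal a' b')
      = ⟨φ u, hφ u u.2⟩ + ⟨φ v, hφ v v.2⟩ := by ext; simp
    have h2 : (⟨ψ (u + v : centralIdeal a b), hψ _ (u + v).2⟩ : centralIdeal a'' b'')
      = ⟨ψ u, hψ u u.2⟩ + ⟨ψ v, hψ v v.2⟩ := by ext; simp
    rw [h1, h2, map_add, map_add]; rfl
  · intro v
    rw [hB v v.2, ← hg' ⟨φ v, hφ v v.2⟩, ← hg'' ⟨ψ v, hψ v v.2⟩]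
    exact Prod.mk_eq_zero

lemma NFree.of_map (h' : NFree a' b' q N) (φ : R →+ S)
    (hφ : ∀ v ∈ centralIdeal a b, φ v ∈ centralIdeal a' b')
    (hB : ∀ v ∈ centralIdeal a b, v ∈ biderIdeal a b p N ↔ φ v ∈ biderIdeal a' b' q N) :
    NFree a b p N :=
  h'.of_pair h' φ φ hφ hφ fun v hv => by rw [hB v hv, and_self]

end NFree

/-- A commutative ring with two families of elements, seen as a bimodule. -/
structure BObj where
  /-- the underlying ring -/
  R : Type
  /-- its ring structure -/
  ring : CommRing R
  /-- left action of the variables -/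
  x : ℕ → R
  /-- right action of the variables -/
  y : ℕ → R

attribute [instance] BObj.ring

namespace BObj

variable (M M' M'' : BObj)

/-- Exchange the two actions. -/
abbrev op : BObj := ⟨M.R, M.ring, M.y, M.x⟩

/-- `NFree` for the two actions on a bimodule. -/
def Free (p : MvPolynomial ℕ ℤ) (N : ℕ) : Prop := NFree M.x M.y p N

variable {M M' M''} {p : MvPolynomial ℕ ℤ} {N : ℕ}

lemma Free.op (h : M.Free p N) : M.op.Free p N := NFree.swap h

/-- Additive maps commuting with both actions. -/
structure IsHom (M M' : BObj) (φ : M.R →+ M'.R) : Prop where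
  x (j : ℕ) (v : M.R) : φ (M.x j * v) = M'.x j * φ v
  y (j : ℕ) (v : M.R) : φ (M.y j * v) = M'.y j * φ v

lemma map_aeval_mul {R S : Type*} [CommRing R] [CommRing S] {a : ℕ → R} {b : ℕ → S} {φ : R →+ S}
    (h : ∀ j v, φ (a j * v) = b j * φ v) (f : MvPolynomial ℕ ℤ) :
    ∀ v, φ (aeval a f * v) = aeval b f * φ v := by
  induction f using MvPolynomial.induction_on with
  | C c =>
    intro v
    have h1 : (C c : MvPolynomial ℕ ℤ) = c • 1 := by simp
    simp only [h1, map_zsmul, map_one, smul_mul_assoc, one_mul]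
  | add f g hf hg =>
    intro v
    rw [map_add (aeval a), map_add (aeval b), add_mul, add_mul, map_add, hf, hg]
  | mul_X f j hf =>
    intro v
    rw [map_mul (aeval a), map_mul (aeval b), aeval_X, aeval_X, mul_assoc, hf, h, mul_assoc]

lemma IsHom.comp_isBider {φ : M.R →+ M'.R} (h : IsHom M M' φ) {D : MvPolynomial ℕ ℤ →+ M.R}
    (hD : IsBider M.x M.y D) : IsBider M'.x M'.y (φ.comp D) := by
  intro f g
  simp only [AddMonoidHom.comp_apply, hD f g, map_add, map_aeval_mul h.x]
  rw [mul_comm (D f), map_aeval_mul h.y, mul_comm (φ (D f))]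

lemma IsHom.map_central {φ : M.R →+ M'.R} (h : IsHom M M' φ) {v : M.R}
    (hv : v ∈ centralIdeal M.x M.y) : φ v ∈ centralIdeal M'.x M'.y := by
  intro j
  rw [← h.x, hv j, h.y]

lemma IsHom.map_bider {φ : M.R →+ M'.R} (h : IsHom M M' φ) {v : M.R}
    (hv : v ∈ biderIdeal M.x M.y p N) : φ v ∈ biderIdeal M'.x M'.y p N := by
  obtain ⟨hv, D, hD, hDv⟩ := hv
  refine ⟨h.map_central hv, φ.comp D, h.comp_isBider hD, ?_⟩
  rw [AddMonoidHom.comp_apply, ← hDv, ← nsmul_eq_mul, ← nsmul_eq_mul, map_nsmul]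

/-- `M` is a direct summand of `M' ⊕ M''`. -/
def Summ (M M' M'' : BObj) : Prop :=
  ∃ (φ : M.R →+ M'.R) (ψ : M'.R →+ M.R) (φ' : M.R →+ M''.R) (ψ' : M''.R →+ M.R),
    IsHom M M' φ ∧ IsHom M' M ψ ∧ IsHom M M'' φ' ∧ IsHom M'' M ψ' ∧
      ∀ v, ψ (φ v) + ψ' (φ' v) = v

/-- `M` is a direct summand of `M'`. -/
def Retr (M M' : BObj) : Prop :=
  ∃ (φ : M.R →+ M'.R) (ψ : M'.R →+ M.R), IsHom M M' φ ∧ IsHom M' M ψ ∧ ∀ v, ψ (φ v) = v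

lemma Retr.summ (h : Retr M M') : Summ M M' M' := by
  obtain ⟨φ, ψ, hφ, hψ, h⟩ := h
  exact ⟨φ, ψ, 0, 0, hφ, hψ, ⟨by simp, by simp⟩, ⟨by simp, by simp⟩, by simpa using h⟩

lemma Retr.refl (M : BObj) : Retr M M :=
  ⟨.id _, .id _, ⟨fun _ _ => rfl, fun _ _ => rfl⟩, ⟨fun _ _ => rfl, fun _ _ => rfl⟩, fun _ => rfl⟩

lemma Free.of_summ (h : Summ M M' M'') (h' : M'.Free p N) (h'' : M''.Free p N) :
    M.Free p N := by
  obtain ⟨φ, ψ, φ', ψ', hφ, hψ, hφ', hψ', H⟩ := h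
  refine NFree.of_pair h' h'' φ φ' (fun v => hφ.map_central) (fun v => hφ'.map_central)
    fun v hv => ⟨fun h => ⟨hφ.map_bider h, hφ'.map_bider h⟩, fun h => ?_⟩
  rw [← H v]
  exact add_mem (hψ.map_bider h.1) (hψ'.map_bider h.2)

lemma Free.of_retr (h : Retr M M') (h' : M'.Free p N) : M.Free p N := h'.of_summ h.summ h'

lemma IsHom.op {φ : M.R →+ M'.R} (h : IsHom M M' φ) : IsHom M.op M'.op φ := ⟨h.y, h.x⟩

lemma Summ.op (h : Summ M M' M'') : Summ M.op M'.op M''.op := by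
  obtain ⟨φ, ψ, φ', ψ', hφ, hψ, hφ', hψ', H⟩ := h
  exact ⟨φ, ψ, φ', ψ', hφ.op, hψ.op, hφ'.op, hψ'.op, H⟩

lemma Retr.op (h : Retr M M') : Retr M.op M'.op := by
  obtain ⟨φ, ψ, hφ, hψ, H⟩ := h
  exact ⟨φ, ψ, hφ.op, hψ.op, H⟩

/-- The coefficients of `δ` in the right action of the variables. -/
def sg (i j : ℕ) : ℤ := if j = i then 1 else if j = i + 1 then -1 else 0

/-- The bimodule obtained by adjoining `δ` with `δ (δ + y i - y (i + 1)) = 0`. -/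
def right (i : ℕ) (M : BObj) : BObj where
  R := QuadraticAlgebra M.R 0 (M.y (i + 1) - M.y i)
  ring := inferInstance
  x j := ⟨M.x j, 0⟩
  y j := ⟨M.y j, sg i j⟩

/-- The same construction for the left action. -/
abbrev left (i : ℕ) (M : BObj) : BObj := (right i M.op).op

/-- The componentwise action of `right` on maps. -/
def rightMap (i : ℕ) (φ : M.R →+ M'.R) : (right i M).R →+ (right i M').R where
  toFun v := ⟨φ v.re, φ v.im⟩
  map_zero' := by
    change (⟨φ 0, φ 0⟩ : QuadraticAlgebra _ _ _) = ⟨0, 0⟩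
    rw [map_zero]
  map_add' u v := by
    change (⟨φ (u.re + v.re), φ (u.im + v.im)⟩ : QuadraticAlgebra _ _ _) = ⟨_, _⟩
    rw [map_add, map_add]

lemma IsHom.right {φ : M.R →+ M'.R} (h : IsHom M M' φ) (i : ℕ) :
    IsHom (right i M) (right i M') (rightMap i φ) := by
  constructor
  · intro j v
    refine QuadraticAlgebra.ext ?_ ?_
    · change φ (M.x j * v.re + 0 * 0 * v.im) = M'.x j * φ v.re + 0 * 0 * φ v.im
      simp [h.x]
    · change φ (M.x j * v.im + 0 * v.re + (M.y (i+1) - M.y i) * 0 * v.im) =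
        M'.x j * φ v.im + 0 * φ v.re + (M'.y (i+1) - M'.y i) * 0 * φ v.im
      simp [h.x]
  · intro j v
    refine QuadraticAlgebra.ext ?_ ?_
    · change φ (M.y j * v.re + 0 * (sg i j : M.R) * v.im) =
        M'.y j * φ v.re + 0 * (sg i j : M'.R) * φ v.im
      simp [h.y]
    · change φ (M.y j * v.im + (sg i j : M.R) * v.re + (M.y (i+1) - M.y i) * (sg i j : M.R) * v.im) =
        M'.y j * φ v.im + (sg i j : M'.R) * φ v.re
          + (M'.y (i+1) - M'.y i) * (sg i j : M'.R) * φ v.im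
      have e : ∀ w : M.R, φ ((sg i j : M.R) * w) = (sg i j : M'.R) * φ w := fun w => by
        rw [← zsmul_eq_mul, ← zsmul_eq_mul, map_zsmul]
      rw [mul_comm (_ - _), mul_assoc, map_add, map_add, e, e, h.y, sub_mul, map_sub, h.y, h.y]
      ring

lemma Summ.right (h : Summ M M' M'') (i : ℕ) : Summ (right i M) (right i M') (right i M'') := by
  obtain ⟨φ, ψ, φ', ψ', hφ, hψ, hφ', hψ', H⟩ := h
  exact ⟨_, _, _, _, hφ.right i, hψ.right i, hφ'.right i, hψ'.right i, fun v =>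
    QuadraticAlgebra.ext (H v.re) (H v.im)⟩

lemma Retr.right (h : Retr M M') (i : ℕ) : Retr (right i M) (right i M') := by
  obtain ⟨φ, ψ, hφ, hψ, H⟩ := h
  exact ⟨_, _, hφ.right i, hψ.right i, fun v => QuadraticAlgebra.ext (H v.re) (H v.im)⟩

lemma Summ.left (h : Summ M M' M'') (i : ℕ) : Summ (left i M) (left i M') (left i M'') :=
  (h.op.right i).op

lemma Retr.left (h : Retr M M') (i : ℕ) : Retr (left i M) (left i M') :=
  (h.op.right i).op

/-- Apply a list of operations, the head of the list being the outermost one;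
`true` stands for `right`, `false` for `left`. -/
def ops (M : BObj) : List (Bool × ℕ) → BObj
  | [] => M
  | (true, i) :: l => right i (ops M l)
  | (false, i) :: l => left i (ops M l)

@[simp] lemma ops_nil : ops M [] = M := rfl
@[simp] lemma ops_true (i : ℕ) (l) : ops M ((true, i) :: l) = right i (ops M l) := rfl
@[simp] lemma ops_false (i : ℕ) (l) : ops M ((false, i) :: l) = left i (ops M l) := rfl

lemma ops_append (l l') : ops M (l ++ l') = ops (ops M l') l := by
  induction l with
  | nil => rfl
  | cons t l ih =>
    obtain ⟨_ | _, i⟩ := t <;> simp [ih]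

lemma Summ.ops (h : Summ M M' M'') (l) : Summ (ops M l) (ops M' l) (ops M'' l) := by
  induction l with
  | nil => exact h
  | cons t l ih =>
    obtain ⟨_ | _, i⟩ := t
    · exact ih.left i
    · exact ih.right i

lemma Retr.ops (h : Retr M M') (l) : Retr (ops M l) (ops M' l) := by
  induction l with
  | nil => exact h
  | cons t l ih =>
    obtain ⟨_ | _, i⟩ := t
    · exact ih.left i
    · exact ih.right i

end BObj

namespace BObj

variable {M M' M'' : BObj} {i j : ℕ}

/-- Constant coefficient of an element of `right i M`. -/
def re (v : (right i M).R) : M.R := QuadraticAlgebra.re v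

/-- Coefficient of `δ` of an element of `right i M`. -/
def im (v : (right i M).R) : M.R := QuadraticAlgebra.im v

/-- The element `r + s δ` of `right i M`. -/
def rmk (i : ℕ) (r s : M.R) : (right i M).R := QuadraticAlgebra.mk r s

lemma right_ext {u v : (right i M).R} (h : re u = re v) (h' : im u = im v) : u = v :=
  QuadraticAlgebra.ext h h'

@[simp] lemma re_rmk (r s : M.R) : re (rmk i r s) = r := rfl
@[simp] lemma im_rmk (r s : M.R) : im (rmk i r s) = s := rfl
@[simp] lemma re_zero : re (0 : (right i M).R) = 0 := rfl
@[simp] lemma im_zero : im (0 : (right i M).R) = 0 := rfl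
@[simp] lemma re_one : re (1 : (right i M).R) = 1 := rfl
@[simp] lemma im_one : im (1 : (right i M).R) = 0 := rfl
@[simp] lemma re_add (u v : (right i M).R) : re (u + v) = re u + re v := rfl
@[simp] lemma im_add (u v : (right i M).R) : im (u + v) = im u + im v := rfl
@[simp] lemma re_neg (u : (right i M).R) : re (-u) = -re u := rfl
@[simp] lemma im_neg (u : (right i M).R) : im (-u) = -im u := rfl
@[simp] lemma re_sub (u v : (right i M).R) : re (u - v) = re u - re v := rfl
@[simp] lemma im_sub (u v : (right i M).R) : im (u - v) = im u - im v := rfl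
@[simp] lemma re_mul (u v : (right i M).R) : re (u * v) = re u * re v := by
  change QuadraticAlgebra.re u * QuadraticAlgebra.re v
    + 0 * QuadraticAlgebra.im u * QuadraticAlgebra.im v = _
  rw [zero_mul, zero_mul, add_zero]; rfl
@[simp] lemma im_mul (u v : (right i M).R) : im (u * v) =
    re u * im v + im u * re v + (M.y (i + 1) - M.y i) * im u * im v := rfl
@[simp] lemma re_right_x (k : ℕ) : re ((right i M).x k) = M.x k := rfl
@[simp] lemma im_right_x (k : ℕ) : im ((right i M).x k) = 0 := rfl
@[simp] lemma re_right_y (k : ℕ) : re ((right i M).y k) = M.y k := rfl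
lemma im_right_y (k : ℕ) : im ((right i M).y k) = (sg i k : M.R) := rfl
@[simp] lemma im_right_y_self : im ((right i M).y i) = 1 := by simp [im_right_y, sg]
@[simp] lemma im_right_y_succ : im ((right i M).y (i + 1)) = -1 := by simp [im_right_y, sg]
lemma im_right_y_of_ne {k : ℕ} (h : k ≠ i) (h' : k ≠ i + 1) : im ((right i M).y k) = 0 := by
  simp [im_right_y, sg, h, h']
@[simp] lemma re_intCast (n : ℤ) : re ((n : ℤ) : (right i M).R) = n := rfl
@[simp] lemma im_intCast (n : ℤ) : im ((n : ℤ) : (right i M).R) = 0 := rfl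

/-- Maps which are additive and commute with both actions. -/
structure IsHomFun (M M' : BObj) (φ : M.R → M'.R) : Prop where
  add (u v : M.R) : φ (u + v) = φ u + φ v
  x (j : ℕ) (v : M.R) : φ (M.x j * v) = M'.x j * φ v
  y (j : ℕ) (v : M.R) : φ (M.y j * v) = M'.y j * φ v

lemma IsHomFun.isHom {φ : M.R → M'.R} (h : IsHomFun M M' φ) :
    IsHom M M' (AddMonoidHom.mk' φ h.add) := ⟨h.x, h.y⟩

lemma Summ.of_fun (φ : M.R → M'.R) (ψ : M'.R → M.R) (φ' : M.R → M''.R) (ψ' : M''.R → M.R)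
    (hφ : IsHomFun M M' φ) (hψ : IsHomFun M' M ψ) (hφ' : IsHomFun M M'' φ')
    (hψ' : IsHomFun M'' M ψ') (H : ∀ v, ψ (φ v) + ψ' (φ' v) = v) : Summ M M' M'' :=
  ⟨_, _, _, _, hφ.isHom, hψ.isHom, hφ'.isHom, hψ'.isHom, H⟩

lemma Retr.of_fun (φ : M.R → M'.R) (ψ : M'.R → M.R) (hφ : IsHomFun M M' φ)
    (hψ : IsHomFun M' M ψ) (H : ∀ v, ψ (φ v) = v) : Retr M M' :=
  ⟨_, _, hφ.isHom, hψ.isHom, H⟩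

lemma summ_right_right (i : ℕ) (M : BObj) :
    Summ (right i (right i M)) (right i M) (right i M) := by
  let Δ : (right i (right i M)).R := rmk i (rmk i 0 1) 1
  let ι : M.R → (right i (right i M)).R := fun r => rmk i (rmk i r 0) 0
  refine Summ.of_fun (fun v => rmk i (re (re v)) (re (im v)))
    (fun v => ι (re v) + ι (im v) * Δ)
    (fun v => rmk i (im (re v) - re (im v) + im (im v) * (M.y i - M.y (i + 1))) (im (im v)))
    (fun v => (ι (re v) + ι (im v) * Δ) * rmk i (rmk i 0 1) 0)
    ⟨?_, ?_, ?_⟩ ⟨?_, ?_, ?_⟩ ⟨?_, ?_, ?_⟩ ⟨?_, ?_, ?_⟩ ?_ <;> intros <;>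
    repeat' apply right_ext
  all_goals
    simp [ι, Δ, im_right_y] <;> ring

lemma retr_right_comm {i j : ℕ} (h : i + 2 ≤ j ∨ j + 2 ≤ i) (M : BObj) :
    Retr (right i (right j M)) (right j (right i M)) := by
  have h1 : sg i j = 0 := by unfold sg; split_ifs <;> lia
  have h2 : sg i (j + 1) = 0 := by unfold sg; split_ifs <;> lia
  have h3 : sg j i = 0 := by unfold sg; split_ifs <;> lia
  have h4 : sg j (i + 1) = 0 := by unfold sg; split_ifs <;> lia
  refine Retr.of_fun (fun v => rmk j (rmk i (re (re v)) (re (im v)))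
      (rmk i (im (re v)) (im (im v))))
    (fun v => rmk i (rmk j (re (re v)) (re (im v))) (rmk j (im (re v)) (im (im v))))
    ⟨?_, ?_, ?_⟩ ⟨?_, ?_, ?_⟩ ?_ <;> intros <;> repeat' apply right_ext
  all_goals
    simp [im_right_y, h1, h2, h3, h4]
  all_goals ring

/-- The two actions do not interact. -/
lemma retr_left_right (i j : ℕ) (M : BObj) :
    Retr (left i (right j M)) (right j (left i M)) := by
  refine Retr.of_fun (M := left i (right j M)) (M' := right j (left i M))
    (fun v => rmk (M := left i M) j (rmk (M := M.op) i (re (M := M) (re (M := (right j M).op) v))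
        (re (M := M) (im (M := (right j M).op) v)))
      (rmk (M := M.op) i (im (M := M) (re (M := (right j M).op) v))
        (im (M := M) (im (M := (right j M).op) v))))
    (fun v => rmk (M := (right j M).op) i (rmk (M := M) j (re (M := M.op) (re (M := left i M) v))
        (re (M := M.op) (im (M := left i M) v)))
      (rmk (M := M) j (im (M := M.op) (re (M := left i M) v))
        (im (M := M.op) (im (M := left i M) v))))
    ⟨?_, ?_, ?_⟩ ⟨?_, ?_, ?_⟩ ?_ <;> intros <;> repeat' apply right_ext
  all_goals
    simp [im_right_y]

lemma retr_right_left (i j : ℕ) (M : BObj) :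
    Retr (right j (left i M)) (left i (right j M)) :=
  (retr_left_right j i M.op).op

set_option maxHeartbeats 4000000 in
lemma summ_braid (j : ℕ) (M : BObj) :
    Summ (right (j + 1) (right j (right (j + 1) M))) (right j (right (j + 1) (right j M)))
      (right (j + 1) M) := by
  let T := right (j + 1) (right j (right (j + 1) M))
  let T' := right j (right (j + 1) (right j M))
  let S := right (j + 1) M
  let ι : M.R → T.R := fun r => rmk _ (rmk _ (rmk _ r 0) 0) 0
  let ι' : M.R → T'.R := fun r => rmk _ (rmk _ (rmk _ r 0) 0) 0
  let P : T'.R := T'.y j - ι' (M.y j)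
  let Q : T'.R := T'.y j - ι' (M.y (j + 1))
  let A : T'.R := ι' (M.y (j + 2)) - T'.y (j + 2)
  let B : T'.R := ι' (M.y (j + 1)) - T'.y (j + 2)
  let P' : T.R := ι (M.y (j + 2)) - T.y (j + 2)
  let Q' : T.R := ι (M.y (j + 1)) - T.y (j + 2)
  let A' : T.R := T.y j - ι (M.y j)
  let B' : T.R := T.y j - ι (M.y (j + 1))
  let w : T.R := rmk _ (rmk _ (rmk _ (M.y (j + 1) - M.y j) 1) (rmk _ (-1) 0)) 0
  have e1 : sg j (j + 2) = 0 := by unfold sg; split_ifs <;> lia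
  have e2 : sg (j + 1) j = 0 := by unfold sg; split_ifs <;> lia
  have e3 : sg j (j + 1) = -1 := by unfold sg; split_ifs <;> lia
  have e4 : sg j j = 1 := by unfold sg; split_ifs <;> lia
  have e5 : sg (j + 1) (j + 1) = 1 := by unfold sg; split_ifs <;> lia
  have e6 : sg (j + 1) (j + 2) = -1 := by unfold sg; split_ifs <;> lia
  have e7 : j + 1 + 1 = j + 2 := rfl
  have hk : ∀ k, k = j ∨ k = j + 1 ∨ k = j + 2 ∨ (sg j k = 0 ∧ sg (j + 1) k = 0) := by
    intro k
    unfold sg; split_ifs <;> lia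
  refine Summ.of_fun (M := T) (M' := T') (M'' := S)
    (fun v => ι' (re (re (re v))) + ι' (im (re (re v))) * Q + ι' (re (re (im v))) * (A - Q)
        + ι' (im (re (im v))) * B * Q
      + P * (ι' (re (im (re v))) + ι' (im (im (re v))) * Q + ι' (re (im (im v))) * (A - Q)
        + ι' (im (im (im v))) * B * Q))
    (fun v => ι (re (re (re v))) + ι (im (re (re v))) * Q' + ι (re (re (im v))) * (A' - Q')
        + ι (im (re (im v))) * B' * Q'
      + P' * (ι (re (im (re v))) + ι (im (im (re v))) * Q' + ι (re (im (im v))) * (A' - Q')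
        + ι (im (im (im v))) * B' * Q'))
    (fun v => rmk _ (im (re (re v)) - re (re (im v))
      + im (re (im v)) * (M.y (j + 1) - M.y (j + 2))) (im (re (im v))))
    (fun v => (ι (re v) + ι (im v) * P') * w)
    ⟨fun u v => ?_, fun k v => ?_, fun k v => ?_⟩ ⟨fun u v => ?_, fun k v => ?_, fun k v => ?_⟩
    ⟨fun u v => ?_, fun k v => ?_, fun k v => ?_⟩ ⟨fun u v => ?_, fun k v => ?_, fun k v => ?_⟩
    fun v => ?_
  case refine_3 | refine_6 | refine_9 | refine_12 =>
    obtain rfl | rfl | rfl | ⟨hk, hk'⟩ := hk k <;> repeat' apply right_ext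
    all_goals
      simp [ι, ι', P, Q, A, B, P', Q', A', B', w, T, T', S, im_right_y, *]
    all_goals ring
  all_goals
    repeat' apply right_ext
  all_goals
    simp [ι, ι', P, Q, A, B, P', Q', A', B', w, T, T', S, im_right_y, e1, e2, e7]
  all_goals ring

end BObj

namespace BObj

variable {M : BObj} {i : ℕ} {p q : MvPolynomial ℕ ℤ} {N : ℕ}

/-- The embedding of constants. -/
def cst (i : ℕ) (M : BObj) : M.R →+* (right i M).R :=
  algebraMap M.R (QuadraticAlgebra M.R 0 (M.y (i + 1) - M.y i))

@[simp] lemma re_cst (r : M.R) : re (cst i M r) = r := rfl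
@[simp] lemma im_cst (r : M.R) : im (cst i M r) = 0 := rfl

lemma right_x (k : ℕ) : (right i M).x k = cst i M (M.x k) := rfl

lemma right_y_of_ne {k : ℕ} (h : k ≠ i) (h' : k ≠ i + 1) :
    (right i M).y k = cst i M (M.y k) :=
  right_ext rfl (im_right_y_of_ne h h')

lemma right_y_add : (right i M).y i + (right i M).y (i + 1) = cst i M (M.y i + M.y (i + 1)) := by
  apply right_ext <;> simp

lemma right_y_mul : (right i M).y i * (right i M).y (i + 1) = cst i M (M.y i * M.y (i + 1)) := by
  apply right_ext <;> simp

/-- The substitution of the elementary symmetric polynomials in the two variables `X i`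
and `X (i + 1)`. -/
def sym (i j : ℕ) : MvPolynomial ℕ ℤ :=
  if j = i then X i + X (i + 1) else if j = i + 1 then X i * X (i + 1) else X j

@[simp] lemma sym_self : sym i i = X i + X (i + 1) := by simp [sym]
@[simp] lemma sym_succ : sym i (i + 1) = X i * X (i + 1) := by simp [sym]
lemma sym_of_ne {j : ℕ} (h : j ≠ i) (h' : j ≠ i + 1) : sym i j = X j := by simp [sym, h, h']

/-- The freeness property with respect to the actions of the polynomials symmetric in
`X i` and `X (i + 1)`. -/
def FreeSym (i : ℕ) (M : BObj) (q : MvPolynomial ℕ ℤ) (N : ℕ) : Prop :=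
  NFree (fun j => aeval M.x (sym i j)) (fun j => aeval M.y (sym i j)) q N

lemma FreeSym.op (h : FreeSym i M q N) : FreeSym i M.op q N := NFree.swap h

lemma aeval_cst_comp (a : ℕ → M.R) (f : MvPolynomial ℕ ℤ) :
    aeval (fun j => cst i M (a j)) f = cst i M (aeval a f) := by
  rw [aeval_def, aeval_def, hom_eval₂]
  congr 1

lemma aeval_right_x (f : MvPolynomial ℕ ℤ) :
    aeval (right i M).x f = cst i M (aeval M.x f) :=
  aeval_cst_comp M.x f

lemma aeval_right_y_sym (j : ℕ) :
    aeval (right i M).y (sym i j) = cst i M (aeval M.y (sym i j)) := by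
  by_cases h : j = i
  · subst h
    simp only [sym_self, map_add, aeval_X]
    rw [← map_add, right_y_add]
  by_cases h' : j = i + 1
  · subst h'
    simp only [sym_succ, map_mul (aeval _), aeval_X]
    rw [right_y_mul]
  · rw [sym_of_ne h h', aeval_X, aeval_X, right_y_of_ne h h']

lemma aeval_aeval_sym {R : Type*} [CommRing R] (a : ℕ → R) (f : MvPolynomial ℕ ℤ) :
    aeval a (aeval (sym i) f) = aeval (fun j => aeval a (sym i j)) f := by
  rw [← AlgHom.comp_apply, comp_aeval]

lemma aeval_right_y (f : MvPolynomial ℕ ℤ) :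
    aeval (right i M).y (aeval (sym i) f) = cst i M (aeval M.y (aeval (sym i) f)) := by
  rw [aeval_aeval_sym, aeval_aeval_sym, ← aeval_cst_comp]
  simp only [aeval_right_y_sym]

/-- Both actions of `p` agree. -/
def Cen (M : BObj) (p : MvPolynomial ℕ ℤ) : Prop := aeval M.x p = aeval M.y p

lemma Cen.op (h : Cen M p) : Cen M.op p := Eq.symm h

lemma Cen.right (h : Cen M p) (hq : aeval (sym i) q = p) : Cen (right i M) p := by
  rw [Cen, aeval_right_x, ← hq, aeval_right_y, hq, h]

lemma Cen.left (h : Cen M p) (hq : aeval (sym i) q = p) : Cen (left i M) p :=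
  (h.op.right hq).op

lemma aeval_mul_of_central {R : Type*} [CommRing R] {a b : ℕ → R} {v : R}
    (hv : v ∈ centralIdeal a b) (f : MvPolynomial ℕ ℤ) : aeval a f * v = aeval b f * v := by
  induction f using MvPolynomial.induction_on with
  | C c => simp
  | add f g hf hg => rw [map_add, map_add, add_mul, add_mul, hf, hg]
  | mul_X f j hf =>
    rw [map_mul, map_mul, aeval_X, aeval_X, mul_right_comm, hf, mul_assoc, mul_assoc,
      mul_comm v, hv j]

/-- The abbreviated coefficient map. -/
def imHom (i : ℕ) (M : BObj) : (right i M).R →+ M.R := AddMonoidHom.mk' im im_add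

lemma imHom_apply (v : (right i M).R) : imHom i M v = im v := rfl

lemma im_cst_mul (r : M.R) (v : (right i M).R) : im (cst i M r * v) = r * im v := by simp

lemma re_of_central {v : (right i M).R} (hv : v ∈ centralIdeal (right i M).x (right i M).y) :
    re v = (M.x i - M.y (i + 1)) * im v := by
  have := congrArg im (hv i)
  simp at this
  linear_combination -this

lemma eq_of_central {u v : (right i M).R} (hu : u ∈ centralIdeal (right i M).x (right i M).y)
    (hv : v ∈ centralIdeal (right i M).x (right i M).y) (h : im u = im v) : u = v :=
  right_ext (by rw [re_of_central hu, re_of_central hv, h]) h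

lemma im_mem_central {v : (right i M).R} (hv : v ∈ centralIdeal (right i M).x (right i M).y) :
    im v ∈ centralIdeal (fun j => aeval M.x (sym i j)) (fun j => aeval M.y (sym i j)) := by
  intro j
  have := aeval_mul_of_central hv (sym i j)
  rw [aeval_right_x, aeval_right_y_sym] at this
  have := congrArg im this
  rwa [im_cst_mul, im_cst_mul] at this

lemma lift_mem_central {w : M.R}
    (hw : w ∈ centralIdeal (fun j => aeval M.x (sym i j)) (fun j => aeval M.y (sym i j))) :
    ((right i M).y i - (right i M).x (i + 1)) * cst i M w ∈
      centralIdeal (right i M).x (right i M).y := by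
  have h1 := congrArg (cst i M) (hw i)
  have h2 := congrArg (cst i M) (hw (i + 1))
  simp only [sym_self, sym_succ, map_add, map_mul, aeval_X] at h1 h2
  have h3 := right_y_add (i := i) (M := M)
  have h4 := right_y_mul (i := i) (M := M)
  simp only [map_add, map_mul] at h3 h4
  intro j
  by_cases h : j = i
  · subst h
    simp only [right_x]
    linear_combination (right j M).y j * h1 - h2 - (right j M).y j * (cst j M w) * h3 +
      cst j M w * h4
  by_cases h' : j = i + 1
  · subst h'
    simp only [right_x]
    linear_combination (- cst i M (M.x (i + 1))) * h1 + h2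
      + (cst i M (M.x (i+1))) * (cst i M w) * h3 - cst i M w * h4
  · have h5 := congrArg (cst i M) (hw j)
    simp only [sym_of_ne h h', map_mul, aeval_X] at h5
    rw [right_x, right_x, right_y_of_ne h h']
    linear_combination ((right i M).y i - cst i M (M.x (i + 1))) * h5

lemma isBider_im {D : MvPolynomial ℕ ℤ →+ (right i M).R}
    (hD : IsBider (right i M).x (right i M).y D) :
    IsBider (fun j => aeval M.x (sym i j)) (fun j => aeval M.y (sym i j))
      ((imHom i M).comp
        (D.comp (aeval (sym i) : MvPolynomial ℕ ℤ →ₐ[ℤ] _).toRingHom.toAddMonoidHom)) := by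
  intro f g
  have := hD.comp (sym i) f g
  simp only [aeval_right_x, aeval_right_y_sym, aeval_cst_comp] at this
  rw [AddMonoidHom.comp_apply, this, imHom_apply, im_add, mul_comm _ (cst i M _), im_cst_mul,
    im_cst_mul, mul_comm (aeval _ g)]
  rfl

lemma exists_isBider_lift {E : MvPolynomial ℕ ℤ →+ M.R}
    (hE : IsBider (fun j => aeval M.x (sym i j)) (fun j => aeval M.y (sym i j)) E) :
    ∃ D, IsBider (right i M).x (right i M).y D ∧ ∀ f, im (D (aeval (sym i) f)) = E f := by
  let s : ℕ → (right i M).R := fun j => cst i M (E (X j))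
  let F : ℕ → (right i M).R := fun j =>
    if j = i then (right i M).y i * s i - s (i + 1)
    else if j = i + 1 then s (i + 1) - (right i M).x (i + 1) * s i
    else ((right i M).y i - (right i M).x (i + 1)) * s j
  have Fi : F i = (right i M).y i * s i - s (i + 1) := by simp [F]
  have Fi' : F (i + 1) = s (i + 1) - (right i M).x (i + 1) * s i := by simp [F]
  have Fj : ∀ j, j ≠ i → j ≠ i + 1 →
      F j = ((right i M).y i - (right i M).x (i + 1)) * s j := fun j h h' => by simp [F, h, h']
  have hs : ∀ j k, s j * (cst i M (aeval M.x (sym i k)) - cst i M (aeval M.y (sym i k))) =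
      s k * (cst i M (aeval M.x (sym i j)) - cst i M (aeval M.y (sym i j))) := by
    intro j k
    have := congrArg (cst i M) (hE.isKCocycle j k)
    simpa only [map_mul, map_sub] using this
  have h3 := right_y_add (i := i) (M := M)
  have h4 := right_y_mul (i := i) (M := M)
  simp only [map_add, map_mul] at h3 h4
  have c1 : ∀ j, j ≠ i → j ≠ i + 1 → F j * ((right i M).x i - (right i M).y i) =
      F i * ((right i M).x j - (right i M).y j) := by
    intro j h h'
    have e1 := hs j i
    have e2 := hs j (i + 1)
    simp only [sym_self, sym_succ, sym_of_ne h h', map_add, map_mul, aeval_X] at e1 e2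
    rw [Fi, Fj j h h', right_y_of_ne h h']
    simp only [right_x]
    linear_combination (right i M).y i * e1 - e2 - (right i M).y i * s j * h3 + s j * h4
  have c2 : ∀ j, j ≠ i → j ≠ i + 1 → F j * ((right i M).x (i + 1) - (right i M).y (i + 1)) =
      F (i + 1) * ((right i M).x j - (right i M).y j) := by
    intro j h h'
    have e1 := hs j i
    have e2 := hs j (i + 1)
    simp only [sym_self, sym_succ, sym_of_ne h h', map_add, map_mul, aeval_X] at e1 e2
    rw [Fi', Fj j h h', right_y_of_ne h h']
    simp only [right_x]
    linear_combination (-cst i M (M.x (i + 1))) * e1 + e2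
      + cst i M (M.x (i + 1)) * s j * h3 - s j * h4
  have c3 : F i * ((right i M).x (i + 1) - (right i M).y (i + 1)) =
      F (i + 1) * ((right i M).x i - (right i M).y i) := by
    have e1 := hs i (i + 1)
    simp only [sym_self, sym_succ, map_add, map_mul, aeval_X] at e1
    rw [Fi, Fi']
    simp only [right_x]
    linear_combination e1 + s (i + 1) * h3 - s i * h4
  have hF : IsKCocycle (right i M).x (right i M).y F := by
    intro j k
    by_cases hj : j = i
    · subst hj
      by_cases hk : k = j
      · rw [hk]
      by_cases hk' : k = j + 1
      · rw [hk', c3]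
      · rw [c1 k hk hk']
    by_cases hj' : j = i + 1
    · subst hj'
      by_cases hk : k = i
      · rw [hk, c3]
      by_cases hk' : k = i + 1
      · rw [hk']
      · rw [c2 k hk hk']
    by_cases hk : k = i
    · rw [hk, c1 j hj hj']
    by_cases hk' : k = i + 1
    · rw [hk', c2 j hj hj']
    have := hs j k
    rw [sym_of_ne hj hj', sym_of_ne hk hk', aeval_X, aeval_X, aeval_X, aeval_X] at this
    rw [Fj j hj hj', Fj k hk hk', right_y_of_ne hj hj', right_y_of_ne hk hk']
    simp only [right_x]
    linear_combination ((right i M).y i - cst i M (M.x (i + 1))) * this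
  obtain ⟨D, hD, hDX⟩ := hF.exists_isBider
  refine ⟨D, hD, fun f => (isBider_im hD).ext hE (fun j => ?_) f⟩
  change im (D (aeval (sym i) (X j))) = _
  rw [aeval_X]
  by_cases h : j = i
  · subst h
    rw [sym_self, map_add, hDX, hDX, Fi, Fi']
    simp [s]
  by_cases h' : j = i + 1
  · subst h'
    rw [sym_succ, hD, aeval_X, aeval_X, hDX, hDX, Fi, Fi']
    simp [s]
    ring
  · rw [sym_of_ne h h', hDX, Fj j h h']
    simp [s]

lemma mem_biderIdeal_right (hq : aeval (sym i) q = p) (hp : Cen M p) {v : (right i M).R}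
    (hv : v ∈ centralIdeal (right i M).x (right i M).y) :
    v ∈ biderIdeal (right i M).x (right i M).y p N ↔
      im v ∈ biderIdeal (fun j => aeval M.x (sym i j)) (fun j => aeval M.y (sym i j)) q N := by
  constructor
  · rintro ⟨-, D, hD, hDv⟩
    refine ⟨im_mem_central hv, _, isBider_im hD, ?_⟩
    change _ = im (D (aeval (sym i) q))
    rw [hq, ← hDv]
    simp [← nsmul_eq_mul, ← imHom_apply]
  · rintro ⟨-, E, hE, hEv⟩
    obtain ⟨D, hD, hDE⟩ := exists_isBider_lift hE
    refine ⟨hv, D, hD, eq_of_central (Ideal.mul_mem_left _ _ hv)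
      (fun j => hD.central (hp.right hq) j) ?_⟩
    have := hDE q
    rw [hq, ← hEv] at this
    rw [this]
    simp [← nsmul_eq_mul, ← imHom_apply]

lemma free_right_iff (hq : aeval (sym i) q = p) (hp : Cen M p) :
    (right i M).Free p N ↔ FreeSym i M q N := by
  constructor
  · intro h
    refine h.of_map ((AddMonoidHom.mulLeft ((right i M).y i - (right i M).x (i + 1))).comp
      (cst i M).toAddMonoidHom) (fun v => lift_mem_central) fun v hv => ?_
    refine Iff.trans ?_ (mem_biderIdeal_right hq hp (lift_mem_central hv)).symm
    have : im (((right i M).y i - (right i M).x (i + 1)) * cst i M v) = v := by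
      simp
    rw [this]
  · intro h
    exact h.of_map (imHom i M) (fun v => im_mem_central)
      fun v hv => mem_biderIdeal_right hq hp hv

lemma free_left_iff (hq : aeval (sym i) q = p) (hp : Cen M p) :
    (left i M).Free p N ↔ FreeSym i M q N :=
  ⟨fun h => ((free_right_iff hq hp.op).1 h.op).op, fun h => ((free_right_iff hq hp.op).2 h.op).op⟩

lemma free_right_iff_left (hq : aeval (sym i) q = p) (hp : Cen M p) :
    (right i M).Free p N ↔ (left i M).Free p N := by
  rw [free_right_iff hq hp, free_left_iff hq hp]

end BObj

section PowerSum

/-- The power sum in the first `r` variables. -/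
def psumN (r n : ℕ) : MvPolynomial ℕ ℤ := ∑ j ∈ Finset.range r, X j ^ n

/-- The complete homogeneous polynomial of degree `n` in two variables. -/
def hsum {R : Type*} [CommRing R] (n : ℕ) (a b : R) : R :=
  ∑ i ∈ Finset.range (n + 1), a ^ i * b ^ (n - i)

lemma hsum_mul {R : Type*} [CommRing R] {n : ℕ} {a b v : R} (h : a * v = b * v) :
    hsum n a b * v = (n + 1) * (a ^ n * v) := by
  have key : ∀ k, b ^ k * v = a ^ k * v := by
    intro k
    induction k with
    | zero => simp
    | succ k ih => rw [pow_succ, pow_succ, mul_assoc, ← h, mul_left_comm, ih]; ring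
  rw [hsum, Finset.sum_mul]
  have : ∀ i ∈ Finset.range (n + 1), a ^ i * b ^ (n - i) * v = a ^ n * v := by
    intro i hi
    rw [mul_assoc, key, ← mul_assoc, ← pow_add, Nat.add_sub_cancel' (by simpa [Nat.lt_succ_iff] using hi)]
  rw [Finset.sum_congr rfl this]
  simp

variable {R : Type} [CommRing R] {a b : ℕ → R} {r n : ℕ}

lemma IsBider.map_psumN {D : MvPolynomial ℕ ℤ →+ R} (hD : IsBider a b D) :
    D (psumN r (n + 1)) = ∑ j ∈ Finset.range r, D (X j) * hsum n (a j) (b j) := by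
  rw [psumN, map_sum]
  exact Finset.sum_congr rfl fun j _ => hD.map_X_pow j n

lemma mem_biderIdeal_psumN {N : ℕ} {v : R} :
    v ∈ biderIdeal a b (psumN r (n + 1)) N ↔ v ∈ centralIdeal a b ∧
      ∃ f, IsKCocycle a b f ∧
        (N : R) * v = ∑ j ∈ Finset.range r, f j * hsum n (a j) (b j) := by
  rw [mem_biderIdeal]
  refine and_congr_right fun _ => ⟨?_, ?_⟩
  · rintro ⟨D, hD, h⟩
    exact ⟨_, hD.isKCocycle, by rw [h, hD.map_psumN]⟩
  · rintro ⟨f, hf, h⟩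
    obtain ⟨D, hD, hDf⟩ := hf.exists_isBider
    exact ⟨D, hD, by rw [h, hD.map_psumN]; simp only [hDf]⟩

lemma exists_sym_pow (i : ℕ) (n : ℕ) :
    ∃ q : MvPolynomial ℕ ℤ, aeval (BObj.sym i) q = (X i ^ n + X (i + 1) ^ n : MvPolynomial ℕ ℤ) := by
  induction n using Nat.strong_induction_on with
  | _ n ih =>
    match n, ih with
    | 0, _ => exact ⟨2, by rw [map_ofNat]; norm_num⟩
    | 1, _ => exact ⟨X i, by simp⟩
    | n + 2, ih =>
      obtain ⟨q1, h1⟩ := ih (n + 1) (by lia)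
      obtain ⟨q0, h0⟩ := ih n (by lia)
      refine ⟨X i * q1 - X (i + 1) * q0, ?_⟩
      rw [map_sub, map_mul, map_mul, h1, h0, aeval_X, aeval_X, BObj.sym_self, BObj.sym_succ]
      ring

lemma exists_sym_psumN {i r : ℕ} (h : i + 1 < r) (n : ℕ) :
    ∃ q : MvPolynomial ℕ ℤ, aeval (BObj.sym i) q = psumN r n := by
  obtain ⟨q, hq⟩ := exists_sym_pow i n
  refine ⟨q + ∑ j ∈ ((Finset.range r).erase i).erase (i + 1), X j ^ n, ?_⟩
  rw [psumN, ← Finset.add_sum_erase _ _ (Finset.mem_range.2 (Nat.lt_of_succ_lt h)),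
    ← Finset.add_sum_erase ((Finset.range r).erase i) _ (a := i + 1) (by simp [h]), map_add, hq,
    map_sum, ← add_assoc]
  congr 1
  refine Finset.sum_congr rfl fun j hj => ?_
  simp only [Finset.mem_erase] at hj
  rw [map_pow, aeval_X, BObj.sym_of_ne hj.2.1 hj.1]

end PowerSum

open Polynomial in
/-- Division by a monic polynomial reduces freeness over a polynomial ring to the coefficients. -/
lemma NFree.of_monic {A : Type} [CommRing A] {a b : ℕ → A} {a' b' : ℕ → A[X]}
    {p q : MvPolynomial ℕ ℤ} {N : ℕ} (H : NFree a b p N) {h : A[X]} (hh : h.Monic)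
    (hZ : ∀ v, v ∈ centralIdeal a' b' ↔ ∀ k, v.coeff k ∈ centralIdeal a b)
    (hB : ∀ v ∈ centralIdeal a' b', v ∈ biderIdeal a' b' q N ↔
      ∃ θ : A[X], (∀ k, θ.coeff k ∈ centralIdeal a b) ∧
        ∀ k, (v + θ * h).coeff k ∈ biderIdeal a b p N) : NFree a' b' q N := by
  have coeff_iff : ∀ (I : Ideal A) (v : A[X]),
      (∀ k, v.coeff k ∈ I) ↔ v.map (Ideal.Quotient.mk I) = 0 := by
    intro I v
    simp only [Polynomial.ext_iff, Polynomial.coeff_map, Polynomial.coeff_zero, Ideal.Quotient.eq_zero_iff_mem]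
  have mod_mem : ∀ (I : Ideal A) (v : A[X]), (∀ k, v.coeff k ∈ I) →
      ∀ k, (v %ₘ h).coeff k ∈ I := by
    intro I v hv
    rw [coeff_iff] at hv ⊢
    rw [Polynomial.map_modByMonic _ hh, hv, zero_modByMonic]
  have div_mem : ∀ (I : Ideal A) (v : A[X]), (∀ k, v.coeff k ∈ I) →
      ∀ k, (v /ₘ h).coeff k ∈ I := by
    intro I v hv
    rw [coeff_iff] at hv ⊢
    rw [Polynomial.map_divByMonic _ hh, hv, zero_divByMonic]
  have hB' : ∀ v ∈ centralIdeal a' b', v ∈ biderIdeal a' b' q N ↔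
      ∀ k, (v %ₘ h).coeff k ∈ biderIdeal a b p N := by
    intro v hv
    rw [hB v hv]
    constructor
    · rintro ⟨θ, -, hθ⟩
      have := mod_mem _ _ hθ
      rwa [Polynomial.add_modByMonic, (Polynomial.modByMonic_eq_zero_iff_dvd hh).2
        (Dvd.intro_left _ rfl), add_zero] at this
    · intro hv'
      refine ⟨-(v /ₘ h), fun k => ?_, ?_⟩
      · rw [Polynomial.coeff_neg]
        exact neg_mem (div_mem _ _ ((hZ v).1 hv) k)
      · have : v + -(v /ₘ h) * h = v %ₘ h := by
          conv_lhs => rw [← modByMonic_add_div v h]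
          rw [modByMonic_add_div v h]
          linear_combination -(modByMonic_add_div v h)
        rwa [this]
  obtain ⟨L, _, _, g, hg⟩ := H
  refine ⟨Fin (h.natDegree + 1) → L, inferInstance, inferInstance,
    AddMonoidHom.mk' (fun v k => g ⟨((v : A[X]) %ₘ h).coeff k, mod_mem _ _ ((hZ v).1 v.2) k⟩) ?_,
    fun v => ?_⟩
  · intro u v
    funext k
    rw [Pi.add_apply, ← map_add]
    congr 1
    ext
    simp [Polynomial.add_modByMonic]
  · rw [hB' v v.2]
    constructor
    · intro hv k
      by_cases hk : k < h.natDegree + 1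
      · have := congrFun hv ⟨k, hk⟩
        exact (hg _).1 this
      · have : ((v : A[X]) %ₘ h).coeff k = 0 := by
          apply coeff_eq_zero_of_natDegree_lt
          have := Polynomial.natDegree_modByMonic_le (v : A[X]) hh
          lia
        rw [this]
        exact zero_mem _
    · intro hv
      funext k
      exact (hg _).2 (hv k)

/-- Extend scalars to polynomials and make the `r`-th element the polynomial variable. -/
def polyVar {A : Type} [CommRing A] (r : ℕ) (a : ℕ → A) (j : ℕ) : Polynomial A :=
  if j = r then Polynomial.X else Polynomial.C (a j)

@[simp] lemma polyVar_self {A : Type} [CommRing A] (r : ℕ) (a : ℕ → A) :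
    polyVar r a r = Polynomial.X := if_pos rfl

lemma polyVar_of_ne {A : Type} [CommRing A] {r : ℕ} (a : ℕ → A) {j : ℕ} (h : j ≠ r) :
    polyVar r a j = Polynomial.C (a j) := if_neg h

namespace BObj

variable {M M' M'' W : BObj} {r n : ℕ}

lemma Retr.trans (h : Retr M M') (h' : Retr M' M'') : Retr M M'' := by
  obtain ⟨φ, ψ, hφ, hψ, H⟩ := h
  obtain ⟨φ', ψ', hφ', hψ', H'⟩ := h'
  refine ⟨φ'.comp φ, ψ.comp ψ', ⟨fun j v => ?_, fun j v => ?_⟩, ⟨fun j v => ?_, fun j v => ?_⟩,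
    fun v => ?_⟩
  · simp [hφ.x, hφ'.x]
  · simp [hφ.y, hφ'.y]
  · simp [hψ.x, hψ'.x]
  · simp [hψ.y, hψ'.y]
  · simp [H, H']

/-- Adjoin a polynomial variable, which becomes the `r`-th variable on both sides. -/
abbrev poly (r : ℕ) (M : BObj) : BObj :=
  ⟨Polynomial M.R, Polynomial.commRing, polyVar r M.x, polyVar r M.y⟩

lemma poly_x (j : ℕ) : (poly r M).x j = polyVar r M.x j := rfl
lemma poly_y (j : ℕ) : (poly r M).y j = polyVar r M.y j := rfl

lemma retr_right_poly {i : ℕ} (hi : i ≠ r) (hi' : i + 1 ≠ r) (M : BObj) :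
    Retr (right i (poly r M)) (poly r (right i M)) := by
  let δ : Polynomial (right i M).R := Polynomial.C (rmk i 0 1)
  let α : Polynomial M.R →+* Polynomial (right i M).R := Polynomial.mapRingHom (cst i M)
  let g : (right i M).R →+* (right i (poly r M)).R :=
    { toFun := fun v => rmk i (Polynomial.C (re v)) (Polynomial.C (im v))
      map_zero' := by apply right_ext <;> simp
      map_one' := by apply right_ext <;> simp
      map_add' := fun u v => by apply right_ext <;> simp
      map_mul' := fun u v => by
        apply right_ext <;> simp [polyVar_of_ne _ hi, polyVar_of_ne _ hi'] }
  let ψ : Polynomial (right i M).R →+* (right i (poly r M)).R :=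
    Polynomial.eval₂RingHom g (cst i (poly r M) Polynomial.X)
  have hg : ∀ v, g v = rmk i (Polynomial.C (re v)) (Polynomial.C (im v)) := fun _ => rfl
  have hcst : ∀ w : Polynomial M.R, cst i (poly r M) w = rmk i w 0 := fun _ => rfl
  have hψC : ∀ v, ψ (Polynomial.C v) = g v := fun v => by simp [ψ]
  have hψX : ψ Polynomial.X = cst i (poly r M) Polynomial.X := by simp [ψ]
  have hψα : ∀ v, ψ (α v) = cst i (poly r M) v := by
    have : ψ.comp α = cst i (poly r M) := by
      apply Polynomial.ringHom_ext
      · intro a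
        simp only [RingHom.comp_apply, α, Polynomial.coe_mapRingHom, Polynomial.map_C, hψC, hg, hcst]
        apply right_ext <;> simp
      · simp only [RingHom.comp_apply, α, Polynomial.coe_mapRingHom, Polynomial.map_X, hψX]
    exact fun v => congrArg (fun f => f v) this
  have hδ : ∀ a : M.R, α (Polynomial.C a) = Polynomial.C (cst i M a) := fun a => by simp [α]
  have hδ2 : δ * δ = α (Polynomial.C (M.y (i + 1)) - Polynomial.C (M.y i)) * δ := by
    rw [map_sub, hδ, hδ, ← map_sub, ← map_mul, ← map_mul]
    congr 1
    apply right_ext <;> simp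
  have hy : ∀ j, polyVar r (right i M).y j = α (polyVar r M.y j) + (sg i j : Polynomial _) * δ := by
    intro j
    by_cases h : j = r
    · have : sg i j = 0 := by unfold sg; split_ifs <;> lia
      subst h
      simp [this, α]
    · rw [polyVar_of_ne _ h, polyVar_of_ne _ h, hδ,
        ← map_intCast (Polynomial.C : (right i M).R →+* _), ← map_mul, ← map_add]
      congr 1
      apply right_ext <;> simp [im_right_y]
  refine Retr.of_fun (fun v => α (re v) + α (im v) * δ) ψ ⟨?_, ?_, ?_⟩ ⟨?_, ?_, ?_⟩ ?_
  · intro u v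
    simp only [re_add, im_add, map_add]
    ring
  · intro j v
    have : polyVar r (right i M).x j = α (polyVar r M.x j) := by
      by_cases h : j = r
      · subst h
        simp [α]
      · rw [polyVar_of_ne _ h, polyVar_of_ne _ h, hδ, right_x]
    change _ = polyVar r (right i M).x j * _
    rw [this]
    simp only [re_mul, im_mul, re_right_x, im_right_x, mul_zero, zero_mul, add_zero, map_mul]
    ring
  · intro j v
    change _ = polyVar r (right i M).y j * _
    rw [hy]
    simp only [re_mul, im_mul, re_right_y, im_right_y, map_add, map_mul, map_intCast]
    rw [polyVar_of_ne _ hi, polyVar_of_ne _ hi']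
    linear_combination (-((sg i j : ℤ) : Polynomial (right i M).R) * α (im v)) * hδ2
  · intro u v
    exact map_add _ _ _
  · intro j v
    rw [map_mul]
    congr 1
    change ψ (polyVar r (right i M).x j) = _
    by_cases h : j = r
    · subst h
      rw [polyVar_self, hψX, right_x, poly_x, polyVar_self]
    · rw [polyVar_of_ne _ h, hψC, hg, right_x, right_x, poly_x, polyVar_of_ne _ h, hcst]
      apply right_ext <;> simp
  · intro j v
    rw [map_mul]
    congr 1
    change ψ (polyVar r (right i M).y j) = _
    by_cases h : j = r
    · subst h
      rw [polyVar_self, hψX, right_y_of_ne (Ne.symm hi) (Ne.symm hi'), poly_y,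
        polyVar_self]
    · rw [polyVar_of_ne _ h, hψC, hg]
      apply right_ext <;> simp [polyVar_of_ne _ h, im_right_y]
  · intro v
    simp only [map_add, map_mul, hψα, δ, hψC, hg, hcst]
    apply right_ext <;> simp [polyVar_of_ne _ hi, polyVar_of_ne _ hi']

end BObj

/-- Extend scalars to polynomials. -/
def polyC {A : Type} [CommRing A] (a : ℕ → A) (j : ℕ) : Polynomial A := Polynomial.C (a j)

section PolyVar

attribute [local instance] Ring.toIntAlgebra

variable {A : Type} [CommRing A] {a b : ℕ → A} {r s n N : ℕ} {p q : MvPolynomial ℕ ℤ}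

lemma coeff_mem_centralIdeal {u : Polynomial A} :
    u ∈ centralIdeal (polyC a) (polyC b) ↔
      ∀ k, u.coeff k ∈ centralIdeal a b := by
  simp only [mem_centralIdeal, Polynomial.ext_iff, polyC, Polynomial.coeff_C_mul]
  exact forall_comm

lemma coeff_mem_biderIdeal {u : Polynomial A} :
    u ∈ biderIdeal (polyC a) (polyC b) p N ↔
      ∀ k, u.coeff k ∈ biderIdeal a b p N := by
  let W : BObj := ⟨A, inferInstance, a, b⟩
  let W' : BObj := ⟨Polynomial A, inferInstance, polyC a, polyC b⟩
  constructor
  · intro h k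
    have : BObj.IsHom W' W (Polynomial.lcoeff A k).toAddMonoidHom :=
      ⟨fun j v => Polynomial.coeff_C_mul v, fun j v => Polynomial.coeff_C_mul v⟩
    exact this.map_bider h
  · intro h
    have : BObj.IsHom W W' (Polynomial.C : A →+* Polynomial A).toAddMonoidHom :=
      ⟨fun j v => Polynomial.C_mul, fun j v => Polynomial.C_mul⟩
    rw [Polynomial.as_sum_support_C_mul_X_pow u]
    exact sum_mem fun k _ => Ideal.mul_mem_right _ _ (this.map_bider (h k))

lemma hsum_self {R : Type*} [CommRing R] (n : ℕ) (a : R) : hsum n a a = (n + 1) * a ^ n := by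
  have := hsum_mul (n := n) (v := 1) (rfl : a * 1 = a * 1)
  simpa using this

lemma IsKCocycle.update_of_central {R : Type*} [CommRing R] {a b f : ℕ → R} (h : IsKCocycle a b f)
    {r : ℕ} (hr : a r = b r) {θ : R} (hθ : θ ∈ centralIdeal a b) :
    IsKCocycle a b (Function.update f r θ) := by
  intro j k
  have h0 : ∀ j, θ * (a j - b j) = 0 := fun j => by linear_combination hθ j
  by_cases hj : j = r <;> by_cases hk : k = r
  · rw [hj, hk]
  · rw [hj, Function.update_self, Function.update_of_ne hk, h0, hr, sub_self, mul_zero]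
  · rw [hk, Function.update_self, Function.update_of_ne hj, h0, hr, sub_self, mul_zero]
  · rw [Function.update_of_ne hj, Function.update_of_ne hk, h]

lemma polyVar_sub (h : a r = b r) (j : ℕ) :
    polyVar r a j - polyVar r b j = polyC a j - polyC b j := by
  by_cases hj : j = r
  · subst hj
    simp [polyC, h]
  · rw [polyVar_of_ne _ hj, polyVar_of_ne _ hj, polyC, polyC]

lemma isKCocycle_polyVar_iff (h : a r = b r) {f : ℕ → Polynomial A} :
    IsKCocycle (polyVar r a) (polyVar r b) f ↔ IsKCocycle (polyC a) (polyC b) f := by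
  unfold IsKCocycle
  simp only [polyVar_sub h]

lemma mem_centralIdeal_polyVar (h : a r = b r) {v : Polynomial A} :
    v ∈ centralIdeal (polyVar r a) (polyVar r b) ↔ v ∈ centralIdeal (polyC a) (polyC b) := by
  simp only [mem_centralIdeal, ← sub_eq_zero (b := _ * v), ← sub_mul, polyVar_sub h]

lemma sum_polyVar (f : ℕ → Polynomial A) :
    ∑ j ∈ Finset.range r, f j * hsum n (polyVar r a j) (polyVar r b j) =
      ∑ j ∈ Finset.range r, f j * hsum n (polyC a j) (polyC b j) := by
  refine Finset.sum_congr rfl fun j hj => ?_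
  have : j ≠ r := (Finset.mem_range.1 hj).ne
  rw [polyVar_of_ne _ this, polyVar_of_ne _ this, polyC, polyC]

lemma NFree.polyVar (H : NFree a b (psumN r (n + 1)) (n + 1)) (h : a r = b r) :
    NFree (polyVar r a) (polyVar r b) (psumN (r + 1) (n + 1)) (n + 1) := by
  refine NFree.of_monic H (Polynomial.monic_X_pow n)
    (fun v => (mem_centralIdeal_polyVar h).trans coeff_mem_centralIdeal) fun v hv => ?_
  have hv' := (mem_centralIdeal_polyVar h).1 hv
  simp only [← coeff_mem_centralIdeal, ← coeff_mem_biderIdeal]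
  rw [mem_biderIdeal_psumN]
  constructor
  · rintro ⟨-, f, hf, hE⟩
    rw [Finset.sum_range_succ, polyVar_self, polyVar_self, hsum_self, sum_polyVar] at hE
    rw [isKCocycle_polyVar_iff h] at hf
    have hθ : -f r ∈ centralIdeal (polyC a) (polyC b) := by
      intro j
      have := hf r j
      simp only [polyC, h, sub_self, mul_zero] at this ⊢
      linear_combination -this
    refine ⟨-f r, hθ, mem_biderIdeal_psumN.2 ⟨add_mem hv' (Ideal.mul_mem_right _ _ hθ), f, hf, ?_⟩⟩
    rw [← sub_eq_iff_eq_add.2 hE]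
    push_cast
    ring
  · rintro ⟨θ, hθ, hB⟩
    obtain ⟨-, f, hf, hE⟩ := mem_biderIdeal_psumN.1 hB
    refine ⟨hv, Function.update f r (-θ), (isKCocycle_polyVar_iff h).2
      (hf.update_of_central (by simp [polyC, h]) (neg_mem hθ)), ?_⟩
    rw [Finset.sum_range_succ, polyVar_self, polyVar_self, hsum_self, sum_polyVar,
      Function.update_self, Finset.sum_congr rfl fun j hj => by
        rw [Function.update_of_ne (Finset.mem_range.1 hj).ne], ← hE]
    push_cast
    ring

/-- The value at power sums of the biderivation along symmetric polynomials supported at the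
second elementary symmetric polynomial. -/
lemma exists_isBider_sym (h : a (s + 1) = b (s + 1))
    (hq : aeval (BObj.sym s) q = psumN (s + 2) (n + 1)) {θ : Polynomial A}
    (hθ : θ ∈ centralIdeal (polyC a) (polyC b)) :
    ∃ G : MvPolynomial ℕ ℤ →+ Polynomial A,
      IsBider (fun j => aeval (polyVar (s + 1) a) (BObj.sym s j))
        (fun j => aeval (polyVar (s + 1) b) (BObj.sym s j)) G ∧
      (∀ j, G (X j) = if j = s + 1 then θ else 0) ∧
      G q = -((n + 1) * θ * ∑ i ∈ Finset.range n,
        Polynomial.X ^ i * Polynomial.C (a s) ^ (n - 1 - i)) := by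
  have hV := (mem_centralIdeal_polyVar h).2 hθ
  have hzero : ∀ {a b f : ℕ → Polynomial A}, (∀ j k, f j * (a k - b k) = 0) →
      IsKCocycle a b f := fun h j k => by rw [h, h]
  obtain ⟨G, hG, hGX⟩ := IsKCocycle.exists_isBider
    (a := fun j => aeval (polyVar (s + 1) a) (BObj.sym s j))
    (b := fun j => aeval (polyVar (s + 1) b) (BObj.sym s j))
    (f := fun j => if j = s + 1 then θ else 0) (hzero fun j k => by
      by_cases h : j = s + 1
      · rw [if_pos h, mul_comm, sub_mul, BObj.aeval_mul_of_central hV, sub_self]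
      · rw [if_neg h, zero_mul])
  obtain ⟨D, hD, hDX⟩ := IsKCocycle.exists_isBider
    (a := polyVar (s + 1) a) (b := polyVar (s + 1) b)
    (f := fun j => if j = s then θ else if j = s + 1 then -θ else 0) (hzero fun j k => by
      by_cases h : j = s
      · rw [if_pos h, mul_comm, sub_mul, hV k, sub_self]
      by_cases h' : j = s + 1
      · rw [if_neg h, if_pos h', mul_comm, sub_mul, mul_neg, mul_neg, hV k, sub_self]
      · rw [if_neg h, if_neg h', zero_mul])
  have hs1 : s ≠ s + 1 := by lia
  refine ⟨G, hG, hGX, ?_⟩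
  have key := (hG.mulLeft (Polynomial.X - Polynomial.C (a s))).ext (hD.comp (BObj.sym s))
    (fun j => by
      change (Polynomial.X - Polynomial.C (a s)) * G (X j) = D (aeval (BObj.sym s) (X j))
      rw [hGX, aeval_X]
      by_cases h : j = s
      · subst h
        rw [BObj.sym_self, map_add, hDX, hDX]
        simp
      by_cases h' : j = s + 1
      · subst h'
        rw [BObj.sym_succ, hD, hDX, hDX, aeval_X, aeval_X, polyVar_of_ne _ hs1, polyVar_self,
          if_pos rfl, if_neg hs1.symm, if_pos rfl, if_pos rfl]
        ring
      · rw [BObj.sym_of_ne h h', hDX, if_neg h, if_neg h', if_neg h', mul_zero]) q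
  change (Polynomial.X - Polynomial.C (a s)) * G q = D (aeval (BObj.sym s) q) at key
  have hs := hV s
  have hlt : ∀ x ∈ Finset.range s,
      D (X x) * hsum n (polyVar (s + 1) a x) (polyVar (s + 1) b x) = 0 := by
    intro x hx
    rw [Finset.mem_range] at hx
    rw [hDX, if_neg (by lia), if_neg (by lia), zero_mul]
  rw [hq, hD.map_psumN, Finset.sum_range_succ, Finset.sum_range_succ, Finset.sum_eq_zero hlt,
    hDX, hDX, if_pos rfl, if_neg hs1.symm, if_pos rfl, mul_comm θ, hsum_mul hs, polyVar_self,
    polyVar_self, hsum_self, polyVar_of_ne _ hs1] at key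
  apply (Polynomial.monic_X_sub_C (a s)).isRegular.left
  dsimp only
  rw [key]
  have hgeom := Commute.geom_sum₂_mul (Commute.all (Polynomial.X : Polynomial A)
    (Polynomial.C (a s))) n
  linear_combination ((n : Polynomial A) + 1) * θ * hgeom

lemma NFree.polyVar_sym (H : NFree a b (psumN (s + 1) (n + 1)) (n + 1))
    (h : a (s + 1) = b (s + 1)) (hn : n ≠ 0)
    (hq : aeval (BObj.sym s) q = psumN (s + 2) (n + 1)) :
    NFree (fun j => aeval (_root_.polyVar (s + 1) a) (BObj.sym s j))
        (fun j => aeval (_root_.polyVar (s + 1) b) (BObj.sym s j)) q (n + 1) := by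
  have hs1 : s ≠ s + 1 := by lia
  set g : Polynomial A := ∑ i ∈ Finset.range n,
    Polynomial.X ^ i * Polynomial.C (a s) ^ (n - 1 - i) with hg
  have hmonic : g.Monic := by
    apply (Polynomial.monic_X_sub_C (a s)).of_mul_monic_right
    rw [hg, Commute.geom_sum₂_mul (Commute.all _ _), ← map_pow]
    exact Polynomial.monic_X_pow_sub_C _ hn
  have hZ : ∀ v, v ∈ centralIdeal (fun j => aeval (_root_.polyVar (s + 1) a) (BObj.sym s j))
      (fun j => aeval (_root_.polyVar (s + 1) b) (BObj.sym s j)) ↔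
      v ∈ centralIdeal (polyC a) (polyC b) := by
    intro v
    rw [← mem_centralIdeal_polyVar h]
    refine ⟨fun hv j => ?_, fun hv j => BObj.aeval_mul_of_central hv _⟩
    by_cases h1 : j = s
    · subst h1
      have := hv j
      simp only [BObj.sym_self, map_add, aeval_X, polyVar_self] at this
      linear_combination this
    by_cases h2 : j = s + 1
    · rw [h2, polyVar_self, polyVar_self]
    · have := hv j
      simpa only [BObj.sym_of_ne h1 h2, aeval_X] using this
  refine NFree.of_monic H hmonic (fun v => (hZ v).trans coeff_mem_centralIdeal) fun v hv => ?_
  have hv' := (hZ v).1 hv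
  simp only [← coeff_mem_centralIdeal, ← coeff_mem_biderIdeal]
  have main : ∀ (D : MvPolynomial ℕ ℤ →+ Polynomial A) (f : ℕ → Polynomial A),
      IsBider (_root_.polyVar (s + 1) a) (_root_.polyVar (s + 1) b) D →
      (∀ j, D (X j) = f j) → f (s + 1) = 0 →
      D (aeval (BObj.sym s) q) =
        ∑ j ∈ Finset.range (s + 1), f j * hsum n (polyC a j) (polyC b j) := by
    intro D f hD hDf hf
    rw [hq, hD.map_psumN, Finset.sum_range_succ, hDf, hf, zero_mul, add_zero, ← sum_polyVar]
    simp only [hDf]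
  constructor
  · rintro ⟨-, E, hE, hEv⟩
    have hco := hE.isKCocycle
    have e1 : aeval (_root_.polyVar (s + 1) a) (BObj.sym s s) -
        aeval (_root_.polyVar (s + 1) b) (BObj.sym s s) = polyC a s - polyC b s := by
      rw [BObj.sym_self, map_add, map_add]
      simp only [aeval_X, polyVar_self, polyVar_of_ne _ hs1, polyC]
      ring
    have e2 : aeval (_root_.polyVar (s + 1) a) (BObj.sym s (s + 1)) -
        aeval (_root_.polyVar (s + 1) b) (BObj.sym s (s + 1)) =
          (polyC a s - polyC b s) * Polynomial.X := by
      rw [BObj.sym_succ, map_mul, map_mul]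
      simp only [aeval_X, polyVar_self, polyVar_of_ne _ hs1, polyC]
      ring
    have e3 : ∀ j, j ≠ s → j ≠ s + 1 → aeval (_root_.polyVar (s + 1) a) (BObj.sym s j) -
        aeval (_root_.polyVar (s + 1) b) (BObj.sym s j) = polyC a j - polyC b j := by
      intro j h1 h2
      rw [BObj.sym_of_ne h1 h2]
      simp only [aeval_X, polyVar_of_ne _ h2, polyC]
    have e4 : polyC a (s + 1) - polyC b (s + 1) = 0 := by rw [polyC, polyC, h, sub_self]
    have hco' : ∀ j k, j ≠ s + 1 → k ≠ s + 1 →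
        E (X j) * (polyC a k - polyC b k) = E (X k) * (polyC a j - polyC b j) := by
      intro j k hj hk
      have := hco j k
      by_cases hj' : j = s <;> by_cases hk' : k = s
      · rw [hj', hk']
      · rw [hj'] at this ⊢
        rwa [e1, e3 k hk' hk] at this
      · rw [hk'] at this ⊢
        rwa [e1, e3 j hj' hj] at this
      · rwa [e3 j hj' hj, e3 k hk' hk] at this
    have hθ : E (X (s + 1)) - Polynomial.X * E (X s) ∈ centralIdeal (polyC a) (polyC b) := by
      intro j
      have h2 := hco (s + 1) s
      rw [e1, e2] at h2
      rcases eq_or_ne j (s + 1) with rfl | hj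
      · linear_combination (E (X (s + 1)) - Polynomial.X * E (X s)) * e4
      rcases eq_or_ne j s with rfl | hj'
      · linear_combination h2
      · have h3 := hco (s + 1) j
        rw [e2, e3 j hj' hj] at h3
        linear_combination h3 - Polynomial.X * hco' s j hs1 hj
    obtain ⟨G, hG, hGX, hGq⟩ := exists_isBider_sym h hq hθ
    have hf : IsKCocycle (polyC a) (polyC b)
        (Function.update (fun j => E (X j)) (s + 1) 0) := by
      intro j k
      by_cases hj : j = s + 1 <;> by_cases hk : k = s + 1
      · rw [hj, hk]
      · rw [hj, Function.update_self, e4, mul_zero, zero_mul]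
      · rw [hk, Function.update_self, e4, mul_zero, zero_mul]
      · rw [Function.update_of_ne hj, Function.update_of_ne hk, hco' j k hj hk]
    obtain ⟨D, hD, hDX⟩ := ((isKCocycle_polyVar_iff h).2 hf).exists_isBider
    have hEDG := hE.ext ((hD.comp (BObj.sym s)).add hG) (fun j => by
      change E (X j) = D (aeval (BObj.sym s) (X j)) + G (X j)
      rw [hGX, aeval_X]
      rcases eq_or_ne j s with rfl | hj'
      · rw [BObj.sym_self, map_add, hDX, hDX, Function.update_self, Function.update_of_ne hs1,
          if_neg hs1, add_zero, add_zero]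
      rcases eq_or_ne j (s + 1) with rfl | hj
      · rw [BObj.sym_succ, hD, hDX, hDX, Function.update_self, Function.update_of_ne hs1,
          if_pos rfl, aeval_X, aeval_X, polyVar_self]
        ring
      · rw [BObj.sym_of_ne hj' hj, hDX, Function.update_of_ne hj, if_neg hj, add_zero]) q
    change E q = D (aeval (BObj.sym s) q) + G q at hEDG
    rw [main D _ hD hDX (by simp), hGq, ← hEv] at hEDG
    refine ⟨_, hθ, mem_biderIdeal_psumN.2 ⟨add_mem hv' (Ideal.mul_mem_right _ _ hθ), _, hf, ?_⟩⟩
    push_cast at hEDG ⊢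
    linear_combination hEDG
  · rintro ⟨θ, hθ, hB⟩
    obtain ⟨-, f, hf, hE⟩ := mem_biderIdeal_psumN.1 hB
    obtain ⟨G, hG, hGX, hGq⟩ := exists_isBider_sym h hq hθ
    obtain ⟨D, hD, hDX⟩ := ((isKCocycle_polyVar_iff h).2
      (hf.update_of_central (r := s + 1) (by simp [polyC, h]) (zero_mem _))).exists_isBider
    refine ⟨hv, _, (hD.comp (BObj.sym s)).add hG, ?_⟩
    change _ = D (aeval (BObj.sym s) q) + G q
    rw [main D _ hD hDX (by simp), hGq, Finset.sum_congr rfl fun j hj => by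
      rw [Function.update_of_ne (Finset.mem_range.1 hj).ne], ← hE]
    push_cast
    ring

end PolyVar

/-- Predicates on words which are inherited along the decompositions of products of
Bott–Samelson bimodules. -/
structure HeckeClosed (P : List ℕ → Prop) : Prop where
  dup (X Y : List ℕ) (i : ℕ) : P (X ++ i :: Y) → P (X ++ i :: i :: Y)
  comm (X Y : List ℕ) (i j : ℕ) : i + 2 ≤ j ∨ j + 2 ≤ i → P (X ++ i :: j :: Y) →
    P (X ++ j :: i :: Y)
  braid (X Y : List ℕ) (j : ℕ) : P (X ++ j :: (j + 1) :: j :: Y) → P (X ++ (j + 1) :: Y) →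
    P (X ++ (j + 1) :: j :: (j + 1) :: Y)

namespace HeckeClosed

variable {P : List ℕ → Prop}

lemma pull_left (hP : HeckeClosed P) {k : ℕ} {V : List ℕ} (hV : ∀ j ∈ V, j + 2 ≤ k) (X Y : List ℕ)
    (h : P (X ++ (k :: V) ++ Y)) : P (X ++ V ++ k :: Y) := by
  induction V generalizing X with
  | nil => simpa using h
  | cons j V ih =>
    have := ih (fun j' hj' => hV j' (List.mem_cons_of_mem _ hj')) (X ++ [j])
      (by simpa using hP.comm X (V ++ Y) k j (.inr (hV j List.mem_cons_self)) (by simpa using h))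
    simpa using this

lemma pull_right (hP : HeckeClosed P) {k : ℕ} {V : List ℕ} (hV : ∀ j ∈ V, j + 2 ≤ k) (X Y : List ℕ)
    (h : P (X ++ V ++ k :: Y)) : P (X ++ (k :: V) ++ Y) := by
  induction V generalizing X with
  | nil => simpa using h
  | cons j V ih =>
    have := ih (fun j' hj' => hV j' (List.mem_cons_of_mem _ hj')) (X ++ [j]) (by simpa using h)
    simpa using hP.comm X (V ++ Y) j k (.inl (hV j List.mem_cons_self)) (by simpa using this)

/-- It suffices to consider words in which the largest letter occurs at most once. -/
lemma of_count_le_one (hP : HeckeClosed P) (k : ℕ) (U X Y : List ℕ) (hU : ∀ j ∈ U, j < k)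
    (h : ∀ U', (∀ j ∈ U', j < k) → U'.count (k - 1) ≤ 1 → P (X ++ U' ++ Y)) :
    P (X ++ U ++ Y) := by
  induction k generalizing U X Y with
  | zero =>
    have : U = [] := List.eq_nil_iff_forall_not_mem.2 fun j hj => Nat.not_lt_zero _ (hU j hj)
    exact h U hU (by simp [this])
  | succ k ih =>
    rw [Nat.add_sub_cancel] at h
    induction hc : U.count k using Nat.strong_induction_on generalizing U with
    | _ c ihc =>
    subst hc
    by_cases h1 : U.count k ≤ 1
    · exact h U hU h1
    obtain ⟨U1, W, rfl, hU1⟩ := List.eq_append_cons_of_mem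
      (List.count_pos_iff.1 (show 0 < U.count k by lia))
    have hW : 0 < W.count k := by
      rw [List.count_append, List.count_cons_self, List.count_eq_zero.2 hU1] at h1
      lia
    obtain ⟨V, U2, rfl, hV⟩ := List.eq_append_cons_of_mem (List.count_pos_iff.1 hW)
    have hVk : ∀ j ∈ V, j < k := fun j hj => lt_of_le_of_ne
      (Nat.lt_succ_iff.1 (hU j (by simp [hj]))) fun e => hV (e ▸ hj)
    suffices P ((X ++ U1 ++ [k]) ++ V ++ (k :: U2 ++ Y)) by simpa using this
    refine ih V _ _ hVk fun V' hV' hc => ?_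
    by_cases hm : k - 1 ∈ V'
    · obtain ⟨V1, V2, rfl, hm1⟩ := List.eq_append_cons_of_mem hm
      have hk : k - 1 < k := hV' (k - 1) hm
      obtain ⟨k, rfl⟩ : ∃ k', k = k' + 1 := ⟨k - 1, by lia⟩
      rw [Nat.add_sub_cancel] at *
      have hm2 : k ∉ V2 := by
        rw [List.count_append, List.count_cons_self] at hc
        exact List.count_eq_zero.1 (by lia)
      have hV1 : ∀ j ∈ V1, j + 2 ≤ k + 1 := fun j hj => by
        have : j ≠ k := fun e => hm1 (e ▸ hj)
        have := hV' j (by simp [hj])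
        lia
      have hV2 : ∀ j ∈ V2, j + 2 ≤ k + 1 := fun j hj => by
        have : j ≠ k := fun e => hm2 (e ▸ hj)
        have := hV' j (by simp [hj])
        lia
      suffices P ((X ++ U1) ++ ((k + 1) :: V1) ++ (k :: V2 ++ (k + 1) :: U2 ++ Y)) by
        simpa using this
      apply hP.pull_right hV1
      suffices P ((X ++ U1 ++ V1 ++ [k + 1, k]) ++ V2 ++ (k + 1) :: (U2 ++ Y)) by simpa using this
      apply hP.pull_left hV2
      suffices P ((X ++ U1 ++ V1) ++ (k + 1) :: k :: (k + 1) :: (V2 ++ U2 ++ Y)) by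
        simpa using this
      have n1 : k + 1 ∉ V1 := fun e => absurd (hV1 _ e) (by lia)
      have n2 : k + 1 ∉ V2 := fun e => absurd (hV2 _ e) (by lia)
      apply hP.braid
      · suffices P (X ++ (U1 ++ V1 ++ k :: (k + 1) :: k :: (V2 ++ U2)) ++ Y) by simpa using this
        refine ihc _ ?_ _ ?_ rfl
        · simp [List.count_eq_zero.2 hU1, List.count_eq_zero.2 hV, List.count_eq_zero.2 n1,
            List.count_eq_zero.2 n2]
        · intro j hj
          simp only [List.mem_append, List.mem_cons] at hj hU hV'
          grind
      · suffices P (X ++ (U1 ++ V1 ++ (k + 1) :: (V2 ++ U2)) ++ Y) by simpa using this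
        refine ihc _ ?_ _ ?_ rfl
        · simp [List.count_eq_zero.2 hU1, List.count_eq_zero.2 hV, List.count_eq_zero.2 n1,
            List.count_eq_zero.2 n2]
        · intro j hj
          simp only [List.mem_append, List.mem_cons] at hj hU hV'
          grind
    · have hV2 : ∀ j ∈ V', j + 2 ≤ k := fun j hj => by
        have : j ≠ k - 1 := fun e => hm (e ▸ hj)
        have := hV' j hj
        lia
      suffices P ((X ++ U1) ++ (k :: V') ++ (k :: (U2 ++ Y))) by simpa using this
      apply hP.pull_right hV2
      apply hP.dup
      suffices P (X ++ (U1 ++ V' ++ k :: U2) ++ Y) by simpa using this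
      have n1 : k ∉ V' := fun e => absurd (hV' _ e) (by lia)
      refine ihc _ ?_ _ ?_ rfl
      · simp [List.count_eq_zero.2 hU1, List.count_eq_zero.2 hV, List.count_eq_zero.2 n1]
      · intro j hj
        simp only [List.mem_append, List.mem_cons] at hj hU hV'
        grind

end HeckeClosed

namespace BObj

variable {M W : BObj} {p q : MvPolynomial ℕ ℤ} {r n N : ℕ}

/-- The operations `right` along a word. -/
abbrev rights (w : List ℕ) : List (Bool × ℕ) := w.map (Prod.mk true)

/-- The operations `left` along a word. -/
abbrev lefts (w : List ℕ) : List (Bool × ℕ) := w.map (Prod.mk false)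

lemma heckeClosed_free (M : BObj) (p : MvPolynomial ℕ ℤ) (N : ℕ) :
    HeckeClosed fun w => (ops M (rights w)).Free p N where
  dup X Y i h := by
    simp only [rights, List.map_append, ops_append, List.map_cons, ops_true] at h ⊢
    exact h.of_summ ((summ_right_right i _).ops _) h
  comm X Y i j hij h := by
    simp only [rights, List.map_append, ops_append, List.map_cons, ops_true] at h ⊢
    exact h.of_retr ((retr_right_comm hij.symm _).ops _)
  braid X Y j h h' := by
    simp only [rights, List.map_append, ops_append, List.map_cons, ops_true] at h h' ⊢
    exact h.of_summ ((summ_braid j _).ops _) h'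

lemma Cen.ops (h : Cen M p) (l : List (Bool × ℕ))
    (hl : ∀ t ∈ l, ∃ q : MvPolynomial ℕ ℤ, aeval (sym t.2) q = p) : Cen (ops M l) p := by
  induction l with
  | nil => exact h
  | cons t l ih =>
    have ih := ih fun t ht => hl t (List.mem_cons_of_mem _ ht)
    obtain ⟨q, hq⟩ := hl t List.mem_cons_self
    obtain ⟨_ | _, i⟩ := t
    · exact ih.left hq
    · exact ih.right hq

lemma retr_left_rights (i : ℕ) (M : BObj) (w : List ℕ) :
    Retr (left i (ops M (rights w))) (ops (left i M) (rights w)) := by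
  induction w with
  | nil => exact Retr.refl _
  | cons j w ih => exact (retr_left_right i j _).trans (ih.right j)

lemma retr_rights_left (i : ℕ) (M : BObj) (w : List ℕ) :
    Retr (ops (left i M) (rights w)) (left i (ops M (rights w))) := by
  induction w with
  | nil => exact Retr.refl _
  | cons j w ih => exact (ih.right j).trans (retr_right_left i j _)

lemma retr_lefts_right (i : ℕ) (M : BObj) (w : List ℕ) :
    Retr (ops (right i M) (lefts w)) (right i (ops M (lefts w))) := by
  induction w with
  | nil => exact Retr.refl _
  | cons j w ih => exact (ih.left j).trans (retr_left_right j i _)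

lemma free_rights_iff (h : Cen M p) (w : List ℕ)
    (hw : ∀ i ∈ w, ∃ q : MvPolynomial ℕ ℤ, aeval (sym i) q = p) :
    (ops M (rights w)).Free p N ↔ (ops M (lefts w.reverse)).Free p N := by
  induction w generalizing M with
  | nil => rfl
  | cons i w ih =>
    have hw' : ∀ i ∈ w, ∃ q : MvPolynomial ℕ ℤ, aeval (sym i) q = p :=
      fun i hi => hw i (List.mem_cons_of_mem _ hi)
    obtain ⟨q, hq⟩ := hw i List.mem_cons_self
    have hc : Cen (ops M (rights w)) p := h.ops _ (by simpa using hw')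
    have h1 := free_right_iff_left (N := N) hq hc
    have h2 : (left i (ops M (rights w))).Free p N ↔ (ops (left i M) (rights w)).Free p N :=
      ⟨fun h => h.of_retr (retr_rights_left i M w), fun h => h.of_retr (retr_left_rights i M w)⟩
    rw [List.reverse_cons, lefts, List.map_append, ops_append]
    exact (h1.trans h2).trans (ih (h.left hq) hw')

lemma retr_ops_poly (M : BObj) (l : List (Bool × ℕ)) (hl : ∀ t ∈ l, t.2 + 1 < r) :
    Retr (ops (poly r M) l) (poly r (ops M l)) := by
  induction l with
  | nil => exact Retr.refl _
  | cons t l ih =>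
    have ih := ih fun t ht => hl t (List.mem_cons_of_mem _ ht)
    have ht := hl t List.mem_cons_self
    obtain ⟨_ | _, i⟩ := t
    · exact (ih.left i).trans
        (retr_right_poly (r := r) (by grind) (by grind) (ops M l).op).op
    · exact (ih.right i).trans (retr_right_poly (by grind) (by grind) _)

lemma ops_x_eq_y (l : List (Bool × ℕ)) (hl : ∀ t ∈ l, t.2 + 1 < r) (h : M.x r = M.y r) :
    (ops M l).x r = (ops M l).y r := by
  induction l with
  | nil => exact h
  | cons t l ih =>
    have ih := ih fun t ht => hl t (List.mem_cons_of_mem _ ht)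
    have ht := hl t List.mem_cons_self
    obtain ⟨_ | _, i⟩ := t
    · change (right i (ops M l).op).y r = (right i (ops M l).op).x r
      rw [right_y_of_ne (by grind) (by grind), right_x]
      exact congrArg _ ih
    · rw [ops_true, right_y_of_ne (by grind) (by grind), right_x, ih]

/-- The polynomial rings in finitely many variables as bimodules over themselves. -/
def tower : ℕ → BObj
  | 0 => ⟨ℤ, inferInstance, 0, 0⟩
  | r + 1 => poly r (tower r)

lemma tower_x_eq_y (r : ℕ) : (tower r).x = (tower r).y := by
  induction r with
  | zero => rfl
  | succ r ih =>
    change polyVar r (tower r).x = polyVar r (tower r).y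
    rw [ih]

lemma cen_tower (r : ℕ) (p : MvPolynomial ℕ ℤ) : Cen (tower r) p := by
  rw [Cen, tower_x_eq_y]

lemma free_tower_zero (n : ℕ) : (tower 0).Free (psumN 0 (n + 1)) (n + 1) := by
  refine ⟨ℤ, inferInstance, inferInstance, (Submodule.subtype _).toAddMonoidHom, fun v => ?_⟩
  change v.1 = 0 ↔ _
  refine ⟨fun h => h ▸ zero_mem _, fun h => ?_⟩
  obtain ⟨-, f, hf, h⟩ := mem_biderIdeal_psumN.1 h
  rw [Finset.range_zero, Finset.sum_empty] at h
  exact ((mul_eq_zero (M₀ := ℤ)).1 h).resolve_left (Nat.cast_ne_zero.2 n.succ_ne_zero)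

section

attribute [local instance] Ring.toIntAlgebra

lemma Cen.poly {k : ℕ} (h : Cen M (psumN r k)) : Cen (poly r M) (psumN (r + 1) k) := by
  have key : ∀ a : ℕ → M.R, aeval (polyVar r a) (psumN (r + 1) k) =
      Polynomial.C (aeval a (psumN r k)) + Polynomial.X ^ k := by
    intro a
    simp only [psumN, map_sum, Finset.sum_range_succ, map_add, map_pow, aeval_X, polyVar_self]
    congr 1
    refine Finset.sum_congr rfl fun j hj => ?_
    rw [polyVar_of_ne _ (Finset.mem_range.1 hj).ne]
  change aeval (polyVar r M.x) _ = aeval (polyVar r M.y) _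
  rw [key, key, h]

end

lemma free_ops_tower (hn : n ≠ 0) (r : ℕ) (w : List ℕ) (hw : ∀ i ∈ w, i + 1 < r) :
    (ops (tower r) (rights w)).Free (psumN r (n + 1)) (n + 1) := by
  induction r generalizing w with
  | zero =>
    have : w = [] := List.eq_nil_iff_forall_not_mem.2 fun j hj => Nat.not_lt_zero _ (hw j hj)
    exact this ▸ free_tower_zero n
  | succ r ih =>
    suffices (fun w => (ops (tower (r + 1)) (rights w)).Free (psumN (r + 1) (n + 1)) (n + 1))
      ([] ++ w ++ []) by simpa using this
    refine (heckeClosed_free _ _ _).of_count_le_one r w [] [] (fun i hi => by grind) ?_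
    intro w hw hc
    rw [List.nil_append, List.append_nil]
    by_cases hm : r - 1 ∈ w
    · obtain ⟨s, rfl⟩ : ∃ s, r = s + 1 := ⟨r - 1, by have := hw _ hm; lia⟩
      rw [Nat.add_sub_cancel] at hm hc
      obtain ⟨Y, Z, rfl, hmY⟩ := List.eq_append_cons_of_mem hm
      rw [List.count_append, List.count_cons_self] at hc
      have hmZ : s ∉ Z := List.count_eq_zero.1 (by lia)
      have hY : ∀ i ∈ Y, i + 1 < s + 1 := fun i hi => by
        have : i ≠ s := fun e => hmY (e ▸ hi)
        have := hw i (by simp [hi])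
        lia
      have hZ : ∀ i ∈ Z, i + 1 < s + 1 := fun i hi => by
        have : i ≠ s := fun e => hmZ (e ▸ hi)
        have := hw i (by simp [hi])
        lia
      have hsym : ∀ i, i < s + 1 →
        ∃ q : MvPolynomial ℕ ℤ, aeval (sym i) q = psumN (s + 2) (n + 1) :=
        fun i hi => exists_sym_psumN (by lia) _
      have hsym' : ∀ i, i < s →
        ∃ q : MvPolynomial ℕ ℤ, aeval (sym i) q = psumN (s + 1) (n + 1) :=
        fun i hi => exists_sym_psumN (by lia) _
      obtain ⟨q, hq⟩ := hsym s (by lia)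
      have hT : (ops (ops (tower (s + 1)) (rights Z)) (lefts Y.reverse)).Free
          (psumN (s + 1) (n + 1)) (n + 1) := by
        rw [← free_rights_iff]
        · rw [← ops_append, ← List.map_append]
          exact ih _ (by grind)
        · exact (cen_tower _ _).ops _ fun t ht => by
            obtain ⟨i, hi, rfl⟩ := List.mem_map.1 ht
            exact hsym' i (by grind)
        · exact fun i hi => hsym' i (by grind)
      rw [rights, List.map_append, ops_append, List.map_cons, ops_true, free_rights_iff]
      · refine Free.of_retr (retr_lefts_right s _ _) ?_
        rw [← ops_append] at hT ⊢
        have hl : ∀ t ∈ lefts Y.reverse ++ rights Z, t.2 + 1 < s + 1 := by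
          intro t ht
          simp only [List.mem_append, List.mem_map, List.mem_reverse] at ht
          grind
        refine Free.of_retr ((retr_ops_poly (tower (s + 1)) _ hl).right s) ?_
        have hx := ops_x_eq_y (M := tower (s + 1)) _ hl (by rw [tower_x_eq_y])
        rw [free_right_iff hq]
        · exact NFree.polyVar_sym hT hx hn hq
        · refine Cen.poly ((cen_tower _ _).ops _ fun t ht => hsym' _ ?_)
          have := hl t ht
          lia
      · refine (Cen.ops (cen_tower _ _) (rights Z) fun t ht => ?_).right hq
        obtain ⟨i, hi, rfl⟩ := List.mem_map.1 ht
        exact hsym i (by grind)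
      · exact fun i hi => hsym i (by grind)
    · have hw' : ∀ i ∈ w, i + 1 < r := fun i hi => by
        have : i ≠ r - 1 := fun e => hm (e ▸ hi)
        have := hw i hi
        lia
      have hl : ∀ t ∈ rights w, t.2 + 1 < r := by simpa using hw'
      refine Free.of_retr (retr_ops_poly (tower r) _ hl) ?_
      exact NFree.polyVar (ih w hw') (ops_x_eq_y (M := tower r) _ hl (by rw [tower_x_eq_y]))

end BObj

section FreeSubmodule

variable {R ι : Type*} [CommRing R] [LinearOrder ι] (N : Submodule R (ι →₀ R))

/-- The ideal of leading coefficients at `i` of the elements of `N` supported in degrees at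
most `i`. -/
def leadIdeal (i : ι) : Ideal R :=
  (N ⊓ ⨅ j > i, LinearMap.ker (Finsupp.lapply j)).map (Finsupp.lapply i)

lemma mem_leadIdeal {i : ι} {r : R} :
    r ∈ leadIdeal N i ↔ ∃ v ∈ N, (∀ j > i, v j = 0) ∧ v i = r := by
  simp [leadIdeal, and_assoc]

lemma exists_lead [IsPrincipalIdealRing R] (i : ι) : ∃ v ∈ N, (∀ j > i, v j = 0) ∧
    v i = Submodule.IsPrincipal.generator (leadIdeal N i) :=
  (mem_leadIdeal N).1 (Submodule.IsPrincipal.generator_mem _)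

/-- Submodules of free modules over principal ideal domains are free. -/
lemma Submodule.free_finsupp_of_isPrincipal [IsDomain R] [IsPrincipalIdealRing R]
    [WellFoundedLT ι] : Module.Free R N := by
  choose w hwN hw0 hwi using exists_lead N
  let S : Set ι := {i | w i i ≠ 0}
  let e : S → N := fun i => ⟨w i, hwN i⟩
  refine Module.Free.of_basis (Module.Basis.mk (v := e) ?_ ?_)
  · refine LinearIndependent.of_comp N.subtype ?_
    rw [linearIndependent_iff]
    intro c hc
    by_contra hne
    have hs := Finsupp.support_nonempty_iff.2 hne
    set m := c.support.max' hs
    have hm : c m ≠ 0 := Finsupp.mem_support_iff.1 (c.support.max'_mem hs)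
    have := congrArg (fun v : ι →₀ R => v m) hc
    simp only [Finsupp.linearCombination_apply, Finsupp.sum, Function.comp_apply,
      Finsupp.coe_finsetSum, Finset.sum_apply, Finsupp.smul_apply, Finsupp.coe_zero, Pi.zero_apply] at this
    rw [Finset.sum_eq_single m] at this
    · exact (mul_ne_zero hm m.2) this
    · intro j hj hjm
      have : j < m := lt_of_le_of_ne (c.support.le_max' _ hj) hjm
      simp [e, hw0 j m this]
    · intro h
      exact absurd (c.support.max'_mem hs) h
  · have key : ∀ i, ∀ v : N, (∀ j > i, (v : ι →₀ R) j = 0) → v ∈ Submodule.span R (Set.range e) := by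
      intro i
      induction i using WellFoundedLT.induction with
      | _ i ih =>
      intro v hv
      have hvi : (v : ι →₀ R) i ∈ leadIdeal N i := (mem_leadIdeal N).2 ⟨v, v.2, hv, rfl⟩
      obtain ⟨k, hk⟩ := (Submodule.IsPrincipal.mem_iff_eq_smul_generator _).1 hvi
      rw [← hwi] at hk
      have hw : k • (⟨w i, hwN i⟩ : N) ∈ Submodule.span R (Set.range e) ∨ w i i = 0 := by
        by_cases h : w i i = 0
        · exact .inr h
        · exact .inl (Submodule.smul_mem _ _ (Submodule.subset_span ⟨⟨i, h⟩, rfl⟩))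
      have step : ∀ v : N, (∀ j > i, (v : ι →₀ R) j = 0) → (v : ι →₀ R) i = 0 →
          v ∈ Submodule.span R (Set.range e) := by
        intro v hv hvi
        by_cases hne : v = 0
        · exact hne ▸ zero_mem _
        have hs := Finsupp.support_nonempty_iff.2 fun h => hne (Subtype.ext h)
        have hm := Finsupp.mem_support_iff.1 ((v : ι →₀ R).support.max'_mem hs)
        refine ih ((v : ι →₀ R).support.max' hs) ?_ v fun j hj => ?_
        · by_contra hlt
          rcases (not_lt.1 hlt).eq_or_lt with h | h
          · exact hm (h ▸ hvi)
          · exact hm (hv _ h)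
        · by_contra h
          exact absurd ((v : ι →₀ R).support.le_max' j (Finsupp.mem_support_iff.2 h)) (not_le.2 hj)
      rcases hw with hw | hw
      · have := step (v - k • ⟨w i, hwN i⟩) (fun j hj => by simp [hv j hj, hw0 i j hj])
          (by simp [hk])
        exact sub_add_cancel v (k • ⟨w i, hwN i⟩) ▸ add_mem this hw
      · exact step v hv (by rw [hk, hw, smul_zero])
    intro v _
    by_cases hne : v = 0
    · exact hne ▸ zero_mem _
    have hs := Finsupp.support_nonempty_iff.2 fun h => hne (Subtype.ext h)
    refine key ((v : ι →₀ R).support.max' hs) v fun j hj => ?_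
    by_contra h
    exact absurd ((v : ι →₀ R).support.le_max' j (Finsupp.mem_support_iff.2 h)) (not_le.2 hj)

end FreeSubmodule

/-- Modules over principal ideal domains which embed in free modules are free. -/
lemma Module.Free.of_injective_of_isPrincipal {R M L : Type*} [CommRing R] [IsDomain R]
    [IsPrincipalIdealRing R] [AddCommGroup M] [Module R M] [AddCommGroup L] [Module R L]
    [Module.Free R L] (f : M →ₗ[R] L) (hf : Function.Injective f) : Module.Free R M := by
  let b := Module.Free.chooseBasis R L
  obtain ⟨_, _⟩ := exists_wellFoundedLT (Module.Free.ChooseBasisIndex R L)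
  let g := b.repr.toLinearMap.comp f
  have hg : Function.Injective g := b.repr.injective.comp hf
  have := Submodule.free_finsupp_of_isPrincipal (LinearMap.range g)
  exact Module.Free.of_equiv (LinearEquiv.ofInjective g hg).symm

namespace BObj

variable {M W : BObj}

lemma tower_hom_ext {S : Type*} [CommRing S] {r : ℕ} {f g : (tower r).R →+* S}
    (h : ∀ j < r, f ((tower r).x j) = g ((tower r).x j)) : f = g := by
  induction r with
  | zero => exact RingHom.ext_int f g
  | succ r ih =>
    refine Polynomial.ringHom_ext' (ih fun j hj => ?_) ?_
    · have := h j (hj.trans r.lt_succ_self)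
      change f (polyVar r (tower r).x j) = g (polyVar r (tower r).x j) at this
      rwa [polyVar_of_ne _ hj.ne] at this
    · have := h r r.lt_succ_self
      change f (polyVar r (tower r).x r) = g (polyVar r (tower r).x r) at this
      rwa [polyVar_self] at this

lemma exists_tower_hom {S : Type*} [CommRing S] (r : ℕ) (c : ℕ → S) :
    ∃ f : (tower r).R →+* S, ∀ j < r, f ((tower r).x j) = c j := by
  induction r with
  | zero => exact ⟨Int.castRingHom S, fun j hj => absurd hj (Nat.not_lt_zero j)⟩
  | succ r ih =>
    obtain ⟨f, hf⟩ := ih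
    refine ⟨Polynomial.eval₂RingHom f (c r), fun j hj => ?_⟩
    change Polynomial.eval₂ f (c r) (polyVar r (tower r).x j) = _
    by_cases h : j = r
    · rw [h, polyVar_self, Polynomial.eval₂_X]
    · rw [polyVar_of_ne _ h, Polynomial.eval₂_C, hf j (by lia)]

lemma rmk_eq (i : ℕ) (v : (right i M).R) : v = cst i M (re v) + cst i M (im v) * rmk i 0 1 := by
  apply right_ext <;> simp

lemma right_y_eq (i j : ℕ) : (right i M).y j = cst i M (M.y j) + ((sg i j : ℤ) : (right i M).R) * rmk i 0 1 := by
  apply right_ext <;> simp [im_right_y]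

lemma isTorsionFree_right (i : ℕ) (h : ∀ (k : ℤ) (v : M.R), k ≠ 0 → k • v = 0 → v = 0) (k : ℤ)
    (v : (right i M).R) (hk : k ≠ 0) (hv : k • v = 0) : v = 0 := by
  rw [zsmul_eq_mul] at hv
  have h1 := congrArg re hv
  have h2 := congrArg im hv
  simp only [re_zero, im_zero, ← zsmul_eq_mul] at h1 h2
  exact right_ext (h k _ hk h1) (h k _ hk h2)

lemma isTorsionFree_poly (i : ℕ) (h : ∀ (k : ℤ) (v : M.R), k ≠ 0 → k • v = 0 → v = 0) (k : ℤ)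
    (v : (poly i M).R) (hk : k ≠ 0) (hv : k • v = 0) : v = 0 := by
  refine Polynomial.ext fun d => h k _ hk ?_
  have := congrArg (fun p : Polynomial M.R => p.coeff d) hv
  rw [zsmul_eq_mul] at this ⊢
  refine Eq.trans ?_ this
  exact (Polynomial.coeff_intCast_mul (S := M.R)).symm

lemma isTorsionFree_tower (r : ℕ) : ∀ (k : ℤ) (v : (tower r).R), k ≠ 0 → k • v = 0 → v = 0 := by
  induction r with
  | zero => exact fun k v hk hv => ((smul_eq_zero (R := ℤ) (M := ℤ)).1 hv).resolve_left hk
  | succ r ih => exact isTorsionFree_poly r ih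

lemma isTorsionFree_ops (r : ℕ) (w : List ℕ) :
    ∀ (k : ℤ) (v : (ops (tower r) (rights w)).R), k ≠ 0 → k • v = 0 → v = 0 := by
  induction w with
  | nil => exact isTorsionFree_tower r
  | cons i w ih => exact isTorsionFree_right i ih

end BObj

section BottSamelson

variable {m l : ℕ} {S : Type*} [CommRing S]

lemma δB_rel (i : Fin l → Fin (m + 1)) (t : Fin l) :
    δB m l i t * (δB m l i t + xB m l i (i t).castSucc - xB m l i (i t).succ
      + 2 * ∑ s ∈ Finset.univ.filter fun s => s < t ∧ i s = i t, δB m l i s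
      - ∑ s ∈ Finset.univ.filter
          fun s => s < t ∧ ((i s : ℕ) = (i t : ℕ) + 1 ∨ (i t : ℕ) = (i s : ℕ) + 1),
          δB m l i s) = 0 := by
  have : Ideal.Quotient.mk (Ideal.span (Set.range (BSrel m l i))) (BSrel m l i t) = 0 :=
    Ideal.Quotient.eq_zero_iff_mem.2 (Ideal.subset_span ⟨t, rfl⟩)
  simp only [BSrel, map_mul, map_add, map_sub, map_sum, map_ofNat] at this
  exact this

/-- Ring homomorphisms out of a Bott–Samelson ring. -/
def bsLift (i : Fin l → Fin (m + 1)) (a : Fin (m + 2) → S) (d : Fin l → S)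
    (h : ∀ t, d t * (d t + a (i t).castSucc - a (i t).succ
      + 2 * ∑ s ∈ Finset.univ.filter fun s => s < t ∧ i s = i t, d s
      - ∑ s ∈ Finset.univ.filter
          fun s => s < t ∧ ((i s : ℕ) = (i t : ℕ) + 1 ∨ (i t : ℕ) = (i s : ℕ) + 1), d s) = 0) :
    BSRing m l i →+* S :=
  Ideal.Quotient.lift _ (eval₂Hom (Int.castRingHom S) (Sum.elim a d)) fun p hp => by
    rw [← RingHom.mem_ker]
    refine Ideal.span_le.2 ?_ hp
    rintro _ ⟨t, rfl⟩
    rw [SetLike.mem_coe, RingHom.mem_ker]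
    simpa only [BSrel, map_mul, map_add, map_sub, map_sum, map_ofNat, coe_eval₂Hom, eval₂_X,
      Sum.elim_inl, Sum.elim_inr] using h t

section

variable {i : Fin l → Fin (m + 1)} {a : Fin (m + 2) → S} {d : Fin l → S}

@[simp] lemma bsLift_xB (h) (j : Fin (m + 2)) : bsLift i a d h (xB m l i j) = a j := by
  simp [bsLift, xB]

@[simp] lemma bsLift_δB (h) (t : Fin l) : bsLift i a d h (δB m l i t) = d t := by
  simp [bsLift, δB]

lemma bs_hom_ext {f g : BSRing m l i →+* S} (hx : ∀ j, f (xB m l i j) = g (xB m l i j))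
    (hd : ∀ t, f (δB m l i t) = g (δB m l i t)) : f = g := by
  refine Ideal.Quotient.ringHom_ext (MvPolynomial.ringHom_ext (fun k => ?_) ?_)
  · exact RingHom.congr_fun (RingHom.ext_int ((f.comp (Ideal.Quotient.mk _)).comp C)
      ((g.comp (Ideal.Quotient.mk _)).comp C)) k
  · rintro (j | t)
    exacts [hx j, hd t]

end

lemma sum_filter_castSucc_lt (i : Fin (l + 1) → Fin (m + 1)) (t : Fin l) (d : Fin (l + 1) → S)
    (P : Fin (m + 1) → Prop) [DecidablePred P] :
    ∑ s ∈ Finset.univ.filter (fun s => s < t.castSucc ∧ P (i s)), d s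
      = ∑ s ∈ Finset.univ.filter (fun s => s < t ∧ P (i s.castSucc)), d s.castSucc := by
  simp [Finset.sum_filter, Fin.sum_univ_castSucc, Fin.castSucc_lt_castSucc_iff,
    (Fin.castSucc_lt_last t).not_gt]

lemma sum_filter_lt_last (i : Fin (l + 1) → Fin (m + 1)) (d : Fin (l + 1) → S)
    (P : Fin (m + 1) → Prop) [DecidablePred P] :
    ∑ s ∈ Finset.univ.filter (fun s => s < Fin.last l ∧ P (i s)), d s
      = ∑ s ∈ Finset.univ.filter (fun s : Fin l => P (i s.castSucc)), d s.castSucc := by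
  simp [Finset.sum_filter, Fin.sum_univ_castSucc]

variable (i : Fin (l + 1) → Fin (m + 1))

/-- The inclusion of the Bott–Samelson ring of the sequence without its last letter. -/
def bsIncl : BSRing m l (fun t => i t.castSucc) →+* BSRing m (l + 1) i :=
  bsLift _ (xB m (l + 1) i) (fun t => δB m (l + 1) i t.castSucc) fun t => by
    rw [← δB_rel i t.castSucc, sum_filter_castSucc_lt i t _ fun k => k = i t.castSucc,
      sum_filter_castSucc_lt i t _ fun k => (k : ℕ) = (i t.castSucc : ℕ) + 1 ∨
        (i t.castSucc : ℕ) = (k : ℕ) + 1]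

lemma δhat_sub (i : Fin l → Fin (m + 1)) (k : Fin (m + 1)) :
    yB m l i k.castSucc - yB m l i k.succ = xB m l i k.castSucc - xB m l i k.succ
      + 2 * ∑ s ∈ Finset.univ.filter fun s => i s = k, δB m l i s
      - ∑ s ∈ Finset.univ.filter
          fun s => (i s : ℕ) = (k : ℕ) + 1 ∨ (k : ℕ) = (i s : ℕ) + 1, δB m l i s := by
  have h1 : δhat m l i (k : ℤ) = ∑ s ∈ Finset.univ.filter fun s => i s = k, δB m l i s := by
    unfold δhat
    congr! 2 with s
    rw [Fin.ext_iff]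
    lia
  have h2 : δhat m l i ((k : ℤ) + 1) + δhat m l i ((k : ℤ) - 1) = ∑ s ∈ Finset.univ.filter
      fun s => (i s : ℕ) = (k : ℕ) + 1 ∨ (k : ℕ) = (i s : ℕ) + 1, δB m l i s := by
    rw [Finset.filter_or, Finset.sum_union]
    · unfold δhat
      congr 2
      · refine Finset.filter_congr fun s _ => ?_
        omega
      · refine Finset.filter_congr fun s _ => ?_
        omega
    · rw [Finset.disjoint_filter]
      intro s _ h h'
      omega
  rw [← h1, ← h2, yB, yB, Fin.val_castSucc, Fin.val_succ, Nat.cast_succ, add_sub_cancel_right]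
  ring

lemma δhat_succ (c : ℤ) : δhat m (l + 1) i c = bsIncl i (δhat m l (fun t => i t.castSucc) c)
    + if ((i (Fin.last l) : ℕ) : ℤ) = c then δB m (l + 1) i (Fin.last l) else 0 := by
  simp only [δhat, Finset.sum_filter, Fin.sum_univ_castSucc, map_sum, bsIncl, apply_ite, map_zero,
    bsLift_δB]
  split_ifs <;> rfl

lemma yB_succ (j : Fin (m + 2)) : yB m (l + 1) i j = bsIncl i (yB m l (fun t => i t.castSucc) j)
    + (BObj.sg (i (Fin.last l)) j : ℤ) * δB m (l + 1) i (Fin.last l) := by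
  have h : bsIncl i (xB m l (fun t => i t.castSucc) j) = xB m (l + 1) i j := bsLift_xB _ _
  simp only [yB, map_add, map_sub, δhat_succ, h, BObj.sg]
  split_ifs <;> first | omega | (push_cast; ring)

lemma δB_last_mul : δB m (l + 1) i (Fin.last l) * δB m (l + 1) i (Fin.last l)
    = bsIncl i (yB m l (fun t => i t.castSucc) (i (Fin.last l)).succ
      - yB m l (fun t => i t.castSucc) (i (Fin.last l)).castSucc)
      * δB m (l + 1) i (Fin.last l) := by
  have h := δB_rel i (Fin.last l)
  rw [sum_filter_lt_last i _ fun k => k = i (Fin.last l),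
    sum_filter_lt_last i _ fun k => (k : ℕ) = (i (Fin.last l) : ℕ) + 1 ∨
        (i (Fin.last l) : ℕ) = (k : ℕ) + 1] at h
  have h' := congrArg (bsIncl i) (δhat_sub (fun t => i t.castSucc) (i (Fin.last l)))
  simp only [map_sub, map_add, map_mul, map_sum, map_ofNat] at h' ⊢
  simp only [bsIncl, bsLift_xB, bsLift_δB] at h' ⊢
  linear_combination h + δB m (l + 1) i (Fin.last l) * h'

end BottSamelson

section Model

open BObj

/-- A Bott–Samelson ring is isomorphic to an iterated extension of the polynomial ring. -/
def BSModel (m l : ℕ) (i : Fin l → Fin (m + 1)) (W : BObj) : Prop :=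
  ∃ e : BSRing m l i ≃+* W.R, (∀ j : Fin (m + 2), e (xB m l i j) = W.x j) ∧
    ∀ j : Fin (m + 2), e (yB m l i j) = W.y j

lemma rmk_mul_self (M : BObj) (k : ℕ) : rmk k (0 : M.R) 1 * rmk k 0 1
    = cst k M (M.y (k + 1) - M.y k) * rmk k 0 1 := by
  apply right_ext <;> simp

lemma bsModel_zero (m : ℕ) (i : Fin 0 → Fin (m + 1)) : BSModel m 0 i (tower (m + 2)) := by
  let f : BSRing m 0 i →+* (tower (m + 2)).R :=
    bsLift i (fun j => (tower (m + 2)).x j) finZeroElim finZeroElim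
  obtain ⟨g, hg⟩ := exists_tower_hom (m + 2)
    (fun j => if h : j < m + 2 then xB m 0 i ⟨j, h⟩ else 0)
  have hf : ∀ j : Fin (m + 2), f (xB m 0 i j) = (tower (m + 2)).x j := fun j => bsLift_xB _ j
  have hg' : ∀ j : Fin (m + 2), g ((tower (m + 2)).x j) = xB m 0 i j := fun j => by
    rw [hg j j.2, dif_pos j.2]
  refine ⟨RingEquiv.ofRingHom f g (tower_hom_ext fun j hj => ?_)
    (bs_hom_ext (fun j => ?_) finZeroElim), hf, fun j => ?_⟩
  · exact (congrArg f (hg' ⟨j, hj⟩)).trans (hf ⟨j, hj⟩)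
  · exact (congrArg g (hf j)).trans (hg' j)
  · have : yB m 0 i j = xB m 0 i j := by simp [yB, δhat]
    rw [this, ← tower_x_eq_y]
    exact hf j

lemma bsModel_succ {m l : ℕ} (i : Fin (l + 1) → Fin (m + 1)) {W : BObj}
    (h : BSModel m l (fun t => i t.castSucc) W) :
    BSModel m (l + 1) i (right (i (Fin.last l)) W) := by
  obtain ⟨e, hx, hy⟩ := h
  set k := i (Fin.last l) with hk
  set ι := bsIncl i
  set δ := δB m (l + 1) i (Fin.last l)
  have hyk : e (yB m l (fun t => i t.castSucc) k.castSucc) = W.y k := hy k.castSucc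
  have hyk' : e (yB m l (fun t => i t.castSucc) k.succ) = W.y (k + 1) := hy k.succ
  let c : BSRing m l (fun t => i t.castSucc) →+* (right k W).R := (cst k W).comp e.toRingHom
  have hc : ∀ v, c v = cst k W (e v) := fun _ => rfl
  let F : BSRing m (l + 1) i →+* (right k W).R :=
    bsLift i (fun j => (right k W).x j)
      (Fin.lastCases (rmk k 0 1) fun t => c (δB m l (fun t => i t.castSucc) t)) fun t => by
      induction t using Fin.lastCases with
      | last =>
        rw [sum_filter_lt_last i _ fun k => k = i (Fin.last l),
          sum_filter_lt_last i _ fun k => (k : ℕ) = (i (Fin.last l) : ℕ) + 1 ∨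
            (i (Fin.last l) : ℕ) = (k : ℕ) + 1]
        have h' := congrArg c (δhat_sub (fun t => i t.castSucc) k)
        simp only [map_sub, map_add, map_mul, map_sum, map_ofNat] at h'
        simp only [hc, hx, hyk, hyk'] at h'
        simp only [Fin.lastCases_last, Fin.lastCases_castSucc, hc, right_x, ← hk]
        have h2 := rmk_mul_self W k
        rw [map_sub] at h2
        linear_combination h2 - rmk k 0 1 * h'
      | cast t =>
        rw [sum_filter_castSucc_lt i t _ fun k => k = i t.castSucc,
          sum_filter_castSucc_lt i t _ fun k => (k : ℕ) = (i t.castSucc : ℕ) + 1 ∨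
            (i t.castSucc : ℕ) = (k : ℕ) + 1]
        have h' := congrArg c (δB_rel (fun t => i t.castSucc) t)
        simp only [map_sub, map_add, map_mul, map_sum, map_ofNat, map_zero] at h'
        simp only [hc, hx] at h'
        simp only [Fin.lastCases_castSucc, hc, right_x]
        exact h'
  have hFx (j : Fin (m + 2)) : F (xB m (l + 1) i j) = (right k W).x j := bsLift_xB _ j
  have hFδ : F δ = rmk k 0 1 := by simp [F, δ]
  have hFι : F.comp ι = c := by
    refine bs_hom_ext (fun j => ?_) fun t => ?_
    · rw [hc, hx, ← right_x, ← hFx, RingHom.comp_apply]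
      exact congrArg F (bsLift_xB _ j)
    · simp [F, ι, bsIncl]
  have hFι' (v) : F (ι v) = cst k W (e v) := RingHom.congr_fun hFι v
  let s : W.R →+* BSRing m (l + 1) i := ι.comp e.symm.toRingHom
  have hs : ∀ v, s v = ι (e.symm v) := fun _ => rfl
  have hδ : δ * δ = s (W.y (k + 1) - W.y k) * δ := by
    rw [hs, map_sub, ← hyk, ← hyk', e.symm_apply_apply, e.symm_apply_apply]
    exact δB_last_mul i
  let G : (right k W).R →+* BSRing m (l + 1) i :=
    { toFun v := s (re v) + s (im v) * δ
      map_zero' := by simp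
      map_one' := by simp
      map_add' u v := by
        simp only [re_add, im_add, map_add]
        ring
      map_mul' u v := by
        rw [map_sub] at hδ
        simp only [re_mul, im_mul, map_add, map_mul, map_sub]
        linear_combination - s (im u) * s (im v) * hδ }
  have hG (v) : G v = s (re v) + s (im v) * δ := rfl
  have hFG : F.comp G = .id _ := by
    ext1 v
    rw [RingHom.comp_apply, hG, map_add, map_mul, hs, hs, hFι', hFι', e.apply_symm_apply,
      e.apply_symm_apply, hFδ]
    exact (rmk_eq k v).symm
  have hGF : G.comp F = .id _ := by
    refine bs_hom_ext (fun j => ?_) fun t => ?_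
    · rw [RingHom.comp_apply, hFx, hG, re_right_x, im_right_x, ← hx, hs, e.symm_apply_apply,
        map_zero, zero_mul, add_zero]
      exact bsLift_xB _ j
    · induction t using Fin.lastCases with
      | last =>
        change G (F δ) = δ
        rw [hFδ, hG]
        simp
      | cast t =>
        have : δB m (l + 1) i t.castSucc = ι (δB m l (fun t => i t.castSucc) t) := by
          simp [ι, bsIncl]
        rw [this, RingHom.comp_apply, hFι', hG, re_cst, im_cst, hs, e.symm_apply_apply]
        simp
  refine ⟨RingEquiv.ofRingHom F G hFG hGF, hFx, fun j => ?_⟩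
  change F (yB m (l + 1) i j) = _
  rw [yB_succ, right_y_eq, map_add, map_mul, map_intCast, hFδ, hFι', hy]

lemma exists_bsModel (m l : ℕ) (i : Fin l → Fin (m + 1)) :
    ∃ w : List ℕ, (∀ k ∈ w, k + 1 < m + 2) ∧ BSModel m l i (ops (tower (m + 2)) (rights w)) := by
  induction l with
  | zero => exact ⟨[], by simp, bsModel_zero m i⟩
  | succ l ih =>
    obtain ⟨w, hw, h⟩ := ih fun t => i t.castSucc
    refine ⟨i (Fin.last l) :: w, ?_, bsModel_succ i h⟩
    rintro k (_ | ⟨_, hk⟩)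
    · omega
    · exact hw k hk

end Model

section Koszul

variable {B : Type*} [CommRing B] {r : ℕ} {z : Fin r → B}

lemma ksign_mul_self (i : Fin r) (t : Finset (Fin r)) : (ksign i t : B) * ksign i t = 1 := by
  rw [ksign, ← mul_pow, neg_one_mul, neg_neg, one_pow]

lemma ksign_erase_left {i j : Fin r} (h : i < j) (t : Finset (Fin r)) (ht : tᶜ = {i, j}) :
    (ksign i t : B) = ksign i (Finset.univ.erase i) := by
  rw [ksign, ksign]
  congr 2
  ext k
  have : k ∈ tᶜ ↔ k = i ∨ k = j := by simp [ht]
  simp only [Finset.mem_compl] at this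
  simp only [Finset.mem_filter, Finset.mem_erase, Finset.mem_univ]
  grind

lemma ksign_erase_right {i j : Fin r} (h : i < j) (t : Finset (Fin r)) (ht : tᶜ = {i, j}) :
    (ksign j t : B) = -ksign j (Finset.univ.erase j) := by
  have h1 : (Finset.univ.erase j).filter (fun k => k < j) =
      insert i (t.filter fun k => k < j) := by
    ext k
    have : k ∈ tᶜ ↔ k = i ∨ k = j := by simp [ht]
    simp only [Finset.mem_compl] at this
    simp only [Finset.mem_filter, Finset.mem_erase, Finset.mem_univ, Finset.mem_insert]
    grind
  have h2 : i ∈ tᶜ := by simp [ht]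
  rw [ksign, ksign, h1, Finset.card_insert_of_notMem (fun h => Finset.mem_compl.1 h2
    (Finset.mem_filter.1 h).1), pow_succ]
  ring

lemma mem_kdeg_top {f : KModule B r} : f ∈ kdeg B r r ↔ ∀ s, s ≠ Finset.univ → f s = 0 := by
  refine forall_congr' fun s => ?_
  rw [Ne, Ne, Nat.cast_inj, ← Finset.card_eq_iff_eq_univ, Fintype.card_fin]

lemma kdeg_eq_bot {q : ℤ} (hq : (r : ℤ) < q) : kdeg B r q = ⊥ := by
  refine eq_bot_iff.2 fun f hf => funext fun s => hf s ?_
  have := s.card_le_univ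
  rw [Fintype.card_fin] at this
  lia

lemma mem_kcycles_top {f : KModule B r} : f ∈ kcycles z r ↔
    (∀ s, s ≠ Finset.univ → f s = 0) ∧ ∀ i, z i * f Finset.univ = 0 := by
  rw [kcycles, Submodule.mem_inf, mem_kdeg_top]
  refine and_congr_right fun hf => ⟨fun h i => ?_, fun h => funext fun t => ?_⟩
  · have := congrFun (LinearMap.mem_ker.1 h) (Finset.univ.erase i)
    have h1 : (Finset.univ.erase i)ᶜ = {i} := by ext; simp
    simp only [koszulD, LinearMap.coe_mk, AddHom.coe_mk, h1, Finset.sum_singleton,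
      Finset.insert_erase (Finset.mem_univ i), Pi.zero_apply] at this
    rw [← one_mul (z i), ← ksign_mul_self i (Finset.univ.erase i), mul_assoc, mul_assoc,
      ← mul_assoc (ksign i _) (z i), this, mul_zero]
  · refine Finset.sum_eq_zero fun i _ => ?_
    by_cases hu : insert i t = Finset.univ
    · rw [hu, mul_assoc, h i, mul_zero]
    · rw [hf _ hu, mul_zero]

lemma mem_kcycles_pred {g : KModule B r} : g ∈ kcycles z ((r : ℤ) - 1) ↔
    g ∈ kdeg B r ((r : ℤ) - 1) ∧
      IsKCocycle z 0 fun i => ksign i (Finset.univ.erase i) * g (Finset.univ.erase i) := by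
  rw [kcycles, Submodule.mem_inf]
  refine and_congr_right fun hg => ?_
  have key {t : Finset (Fin r)} {i j : Fin r} (hij : i < j) (ht : tᶜ = {i, j}) :
      koszulD z g t = ksign i (Finset.univ.erase i) * ksign j (Finset.univ.erase j) *
        (ksign j (Finset.univ.erase j) * g (Finset.univ.erase j) * z i
          - ksign i (Finset.univ.erase i) * g (Finset.univ.erase i) * z j) := by
    have hi : insert i t = Finset.univ.erase j := by
      ext k
      have : k ∈ tᶜ ↔ k = i ∨ k = j := by simp [ht]
      simp only [Finset.mem_compl] at this
      simp only [Finset.mem_insert, Finset.mem_erase, Finset.mem_univ]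
      grind
    have hj : insert j t = Finset.univ.erase i := by
      ext k
      have : k ∈ tᶜ ↔ k = i ∨ k = j := by simp [ht]
      simp only [Finset.mem_compl] at this
      simp only [Finset.mem_insert, Finset.mem_erase, Finset.mem_univ]
      grind
    simp only [koszulD, LinearMap.coe_mk, AddHom.coe_mk]
    rw [ht, Finset.sum_pair hij.ne, hi, hj, ksign_erase_left hij t ht, ksign_erase_right hij t ht]
    linear_combination
      - ksign i (Finset.univ.erase i) * g (Finset.univ.erase j) * z i *
          ksign_mul_self (B := B) j (Finset.univ.erase j)
      + ksign j (Finset.univ.erase j) * g (Finset.univ.erase i) * z j *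
          ksign_mul_self (B := B) i (Finset.univ.erase i)
  refine ⟨fun h => ?_, fun h => funext fun t => ?_⟩
  · have key' {i j : Fin r} (hij : i < j) :
        ksign j (Finset.univ.erase j) * g (Finset.univ.erase j) * z i
          = ksign i (Finset.univ.erase i) * g (Finset.univ.erase i) * z j := by
      have h0 : koszulD z g {i, j}ᶜ = 0 := congrFun (LinearMap.mem_ker.1 h) _
      rw [key hij (compl_compl _)] at h0
      have h1 := congrArg
        (ksign i (Finset.univ.erase i) * ksign j (Finset.univ.erase j) * ·) h0
      rw [mul_zero, ← mul_assoc, mul_mul_mul_comm, ksign_mul_self, ksign_mul_self, one_mul,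
        one_mul] at h1
      exact sub_eq_zero.1 h1
    intro i j
    simp only [Pi.zero_apply, sub_zero]
    rcases lt_trichotomy i j with hij | rfl | hij
    · exact (key' hij).symm
    · rfl
    · exact key' hij
  · by_cases ht : tᶜ.card = 2
    · have key' {i j : Fin r} (hij : i < j) (ht : tᶜ = {i, j}) : koszulD z g t = 0 := by
        have := h i j
        simp only [Pi.zero_apply, sub_zero] at this
        rw [key hij ht, this, sub_self, mul_zero]
      obtain ⟨i, j, hij, ht⟩ := Finset.card_eq_two.1 ht
      rcases hij.lt_or_gt with hij | hij
      · exact key' hij ht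
      · exact key' hij (ht.trans (Finset.pair_comm i j))
    · refine Finset.sum_eq_zero fun i hi => ?_
      rw [hg, mul_zero]
      rw [Finset.card_insert_of_notMem (Finset.mem_compl.1 hi)]
      have := t.card_add_card_compl
      rw [Fintype.card_fin] at this
      lia

lemma extMul_mem_kdeg_top (c : Fin r → B) {g : KModule B r} (hg : g ∈ kdeg B r ((r : ℤ) - 1)) :
    extMul c g ∈ kdeg B r r := by
  intro s hs
  refine Finset.sum_eq_zero fun i hi => ?_
  rw [hg, mul_zero]
  have := Finset.card_erase_add_one hi
  lia

lemma extMul_univ (c : Fin r → B) (g : KModule B r) : extMul c g Finset.univ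
    = ∑ i, c i * (ksign i (Finset.univ.erase i) * g (Finset.univ.erase i)) := by
  simp only [extMul, LinearMap.coe_mk, AddHom.coe_mk]
  exact Finset.sum_congr rfl fun i _ => by ring

/-- The top-degree boundaries together with the multiples of a degree one element. -/
lemma mem_kbdries_sup_map_extMul {c : Fin r → B} {f : KModule B r} (hf : f ∈ kdeg B r r) :
    f ∈ kbdries z r ⊔ Submodule.map (extMul c) (kcycles z ((r : ℤ) - 1)) ↔
      ∃ φ : Fin r → B, IsKCocycle z 0 φ ∧ f Finset.univ = ∑ i, c i * φ i := by
  rw [kbdries, kdeg_eq_bot (by lia), Submodule.map_bot, bot_sup_eq, Submodule.mem_map]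
  constructor
  · rintro ⟨g, hg, rfl⟩
    exact ⟨_, (mem_kcycles_pred.1 hg).2, extMul_univ c g⟩
  · rintro ⟨φ, hφ, h⟩
    let g : KModule B r := fun t => ∑ i, if t = Finset.univ.erase i then ksign i t * φ i else 0
    have hg (i : Fin r) : g (Finset.univ.erase i) = ksign i (Finset.univ.erase i) * φ i := by
      have hinj {j : Fin r} : Finset.univ.erase i = Finset.univ.erase j ↔ i = j :=
        ⟨fun h => by
          by_contra hne
          exact absurd (h ▸ Finset.mem_erase.2 ⟨hne, Finset.mem_univ i⟩)
            (Finset.notMem_erase i _), fun h => h ▸ rfl⟩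
      simp [g, hinj]
    have hg' (i : Fin r) : ksign i (Finset.univ.erase i) * g (Finset.univ.erase i) = φ i := by
      rw [hg, ← mul_assoc, ksign_mul_self, one_mul]
    have hgd : g ∈ kdeg B r ((r : ℤ) - 1) := by
      refine fun s hs => Finset.sum_eq_zero fun i _ => if_neg ?_
      rintro rfl
      have := Finset.card_erase_add_one (Finset.mem_univ i)
      rw [Finset.card_univ, Fintype.card_fin] at this
      lia
    refine ⟨g, mem_kcycles_pred.2 ⟨hgd, by simpa only [hg'] using hφ⟩, funext fun s => ?_⟩
    by_cases hs : s = Finset.univ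
    · rw [hs, h, extMul_univ]
      simp only [hg']
    · rw [mem_kdeg_top.1 hf s hs, mem_kdeg_top.1 (extMul_mem_kdeg_top c hgd) s hs]

end Koszul

namespace BObj

variable {M : BObj} {r : ℕ}

/-- The elementary symmetric functions of the first `r` variables act by the same elements. -/
def EqProd (r : ℕ) (M : BObj) : Prop :=
  ∏ j ∈ Finset.range r, (Polynomial.X + Polynomial.C (M.x j))
    = ∏ j ∈ Finset.range r, (Polynomial.X + Polynomial.C (M.y j))

lemma EqProd.right {i : ℕ} (h : EqProd r M) (hi : i + 1 < r) : EqProd r (right i M) := by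
  have hx := congrArg (Polynomial.map (cst i M)) h
  simp only [Polynomial.map_prod, Polynomial.map_add, Polynomial.map_X, Polynomial.map_C] at hx
  refine hx.trans ?_
  have hi0 : i ∈ Finset.range r := Finset.mem_range.2 (by lia)
  have hi1 : i + 1 ∈ (Finset.range r).erase i :=
    Finset.mem_erase.2 ⟨by lia, Finset.mem_range.2 hi⟩
  rw [← Finset.mul_prod_erase _ _ hi0, ← Finset.mul_prod_erase _ _ hi1,
    ← Finset.mul_prod_erase _ _ hi0, ← Finset.mul_prod_erase _ _ hi1, ← mul_assoc, ← mul_assoc]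
  congr 1
  · have h1 := congrArg Polynomial.C (right_y_add (i := i) (M := M))
    have h2 := congrArg Polynomial.C (right_y_mul (i := i) (M := M))
    simp only [map_add, map_mul] at h1 h2
    linear_combination - Polynomial.X * h1 - h2
  · refine Finset.prod_congr rfl fun k hk => ?_
    simp only [Finset.mem_erase] at hk
    rw [right_y_of_ne hk.2.1 hk.1]

lemma eqProd_ops_tower (w : List ℕ) (hw : ∀ k ∈ w, k + 1 < r) :
    EqProd r (ops (tower r) (rights w)) := by
  induction w with
  | nil =>
    change EqProd r (tower r)
    rw [EqProd, tower_x_eq_y]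
  | cons k w ih =>
    exact (ih fun k hk => hw k (List.mem_cons_of_mem _ hk)).right (hw k List.mem_cons_self)

end BObj

lemma esym_eq_of_prod {R : Type*} [CommRing R] {r : ℕ} {a b : Fin r → R}
    (h : ∏ j, (Polynomial.X + Polynomial.C (a j)) = ∏ j, (Polynomial.X + Polynomial.C (b j)))
    {k : ℕ} (hk : k ≤ r) : esym k a = esym k b := by
  have := congrArg (fun p : Polynomial R => p.coeff (r - k)) h
  have hr : r - k ≤ (Finset.univ : Finset (Fin r)).card := by simp
  rwa [Finset.prod_X_add_C_coeff _ _ hr, Finset.prod_X_add_C_coeff _ _ hr, Finset.card_univ,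
    Fintype.card_fin, Nat.sub_sub_self hk] at this

section Evaluation

open TensorProduct

variable (m n l : ℕ) (i : Fin l → Fin (m + 1))

lemma bs_torsionFree (k : ℤ) (v : BSRing m l i) (hk : k ≠ 0) (hv : k • v = 0) : v = 0 := by
  obtain ⟨w, -, e, -, -⟩ := exists_bsModel m l i
  refine e.injective ?_
  rw [map_zero]
  exact BObj.isTorsionFree_ops _ w k _ hk (by rw [← map_zsmul, hv, map_zero])

lemma bs_natCast_mul_cancel {k : ℕ} {u v : BSRing m l i}
    (h : ((k : BSRing m l i) + 1) * u = (k + 1) * v) :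
    u = v := by
  refine sub_eq_zero.1 (bs_torsionFree m l i (k + 1) _ (by lia) ?_)
  rw [zsmul_eq_mul]
  push_cast
  rw [mul_sub, h, sub_self]

lemma exists_injective_ratAlgebra : ∃ (T : Type) (_ : CommRing T) (_ : Algebra ℚ T)
    (ι : BSRing m l i →+* T), Function.Injective ι := by
  have : Module.IsTorsionFree ℤ (BSRing m l i) := by
    refine ⟨fun k hk u v huv => ?_⟩
    refine sub_eq_zero.1 (bs_torsionFree m l i k _ hk.ne_zero ?_)
    rw [smul_sub, sub_eq_zero]
    exact huv
  exact ⟨ℚ ⊗[ℤ] BSRing m l i, inferInstance, inferInstance,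
    (Algebra.TensorProduct.includeRight : BSRing m l i →ₐ[ℤ] ℚ ⊗[ℤ] BSRing m l i).toRingHom,
    Algebra.TensorProduct.includeRight_injective (algebraMap ℤ ℚ).injective_int⟩

lemma esym_xB_eq {k : ℕ} (hk : k ≤ m + 2) : esym k (xB m l i) = esym k (yB m l i) := by
  obtain ⟨w, hw, e, hx, hy⟩ := exists_bsModel m l i
  refine esym_eq_of_prod ?_ hk
  refine Polynomial.map_injective e.toRingHom e.injective ?_
  have h := BObj.eqProd_ops_tower w hw
  rw [BObj.EqProd, Finset.prod_range, Finset.prod_range] at h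
  simp only [← hx, ← hy] at h
  simp only [Polynomial.map_prod, Polynomial.map_add, Polynomial.map_X, Polynomial.map_C]
  exact h

lemma toBS_Frel (j : Fin (m + 2)) : toBS m l i (Frel (m + 2) j) = 0 := by
  have h := esym_xB_eq m l i (k := j + 1) (by lia)
  simp only [esym] at h
  simp [toBS, Frel, esym, h]

/-- The evaluation of rational polynomials in an extension of a Bott–Samelson ring. -/
lemma exists_FQRing_hom {T : Type*} [CommRing T] [Algebra ℚ T] (ι : BSRing m l i →+* T) :
    ∃ Ψ : FQRing (m + 2) →+* T, ∀ p, Ψ (toFQ (m + 2) p) = ι (toBS m l i p) := by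
  let Ψ : MvPolynomial (Fin (m + 2) ⊕ Fin (m + 2)) ℚ →+* T :=
    eval₂Hom (algebraMap ℚ T) fun v => ι (toBS m l i (X v))
  have hΨ : Ψ.comp (MvPolynomial.map (Int.castRingHom ℚ)) = ι.comp (toBS m l i) := by
    refine MvPolynomial.ringHom_ext (fun k => ?_) fun v => ?_
    · exact RingHom.congr_fun (RingHom.ext_int ((Ψ.comp (MvPolynomial.map _)).comp C)
        ((ι.comp (toBS m l i)).comp C)) k
    · rw [RingHom.comp_apply, map_X]
      exact eval₂_X _ _ v
  refine ⟨Ideal.Quotient.lift _ Ψ fun p hp => ?_, RingHom.congr_fun hΨ⟩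
  rw [← RingHom.mem_ker]
  refine Ideal.span_le.2 ?_ hp
  rintro _ ⟨j, rfl⟩
  rw [SetLike.mem_coe, RingHom.mem_ker]
  refine (RingHom.congr_fun hΨ _).trans ?_
  rw [RingHom.comp_apply, toBS_Frel, map_zero]

lemma sum_antisymm_mul {ι R : Type*} [CommRing R] [Fintype ι] {z f : ι → R}
    (h : IsKCocycle z 0 f) (A : ι → ι → R) : ∑ j, (∑ k, (A k j - A j k) * z k) * f j = 0 := by
  simp only [Finset.sum_mul, sub_mul, Finset.sum_sub_distrib]
  rw [sub_eq_zero, Finset.sum_comm]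
  refine Finset.sum_congr rfl fun j _ => Finset.sum_congr rfl fun k _ => ?_
  have := h j k
  simp only [Pi.zero_apply, sub_zero] at this
  linear_combination - A j k * this

/-- The evaluation of a rational representative of `κ_n` at a cocycle. -/
lemma succ_mul_sum_toBS_mul (c : Fin (m + 2) → FPoly (m + 2))
    (hhom : ∃ a : Fin (m + 2) → Fin (m + 2) → FQRing (m + 2),
      ∀ j : Fin (m + 2),
        toFQ (m + 2) (c j) - kappa (m + 2) n j
          = ∑ i' : Fin (m + 2), (a i' j - a j i') * (xQ (m + 2) i' - yQ (m + 2) i'))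
    {f : Fin (m + 2) → BSRing m l i} (hf : IsKCocycle (fun j => xB m l i j - yB m l i j) 0 f) :
    ((n : BSRing m l i) + 1) * ∑ j, toBS m l i (c j) * f j
      = ∑ j, f j * hsum n (xB m l i j) (yB m l i j) := by
  obtain ⟨a, ha⟩ := hhom
  obtain ⟨T, _, _, ι, hι⟩ := exists_injective_ratAlgebra m l i
  obtain ⟨Ψ, hΨ⟩ := exists_FQRing_hom m l i ι
  have hx (j) : Ψ (xQ (m + 2) j) = ι (xB m l i j) := by simp [xQ, hΨ, toBS]
  have hy (j) : Ψ (yQ (m + 2) j) = ι (yB m l i j) := by simp [yQ, hΨ, toBS]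
  have hκ (j) : ((n : T) + 1) * Ψ (kappa (m + 2) n j)
      = ι (hsum n (xB m l i j) (yB m l i j)) := by
    have hq : (algebraMap ℚ (FQRing (m + 2)) (n + 1)) * algebraMap ℚ _ (1 / (n + 1)) = 1 := by
      rw [← map_mul, mul_one_div_cancel (by positivity), map_one]
    have := congrArg Ψ hq
    rw [map_mul, map_one, map_add, map_natCast, map_one, map_add, map_natCast, map_one] at this
    rw [kappa, map_mul, ← mul_assoc, this, one_mul]
    simp [hsum, hx, hy]
  have hfι : IsKCocycle (fun j => ι (xB m l i j - yB m l i j)) 0 fun j => ι (f j) := by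
    intro j k
    have := congrArg ι (hf j k)
    simpa only [Pi.zero_apply, sub_zero, map_mul] using this
  have hs := sum_antisymm_mul hfι fun j k => Ψ (a j k)
  have ha' (j) : ι (toBS m l i (c j)) - Ψ (kappa (m + 2) n j)
      = ∑ k, (Ψ (a k j) - Ψ (a j k)) * ι (xB m l i k - yB m l i k) := by
    rw [← hΨ, ← map_sub, ha]
    simp [hx, hy]
  simp only [← ha'] at hs
  simp only [sub_mul, Finset.sum_sub_distrib] at hs
  refine hι ?_
  simp only [map_mul, map_sum, map_add, map_natCast, map_one, ← hκ]
  rw [sub_eq_zero.1 hs, Finset.mul_sum]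
  exact Finset.sum_congr rfl fun j _ => by ring

end Evaluation

/-- A quotient which embeds additively in a free abelian group is free. -/
lemma Submodule.free_int_quotient {R K L : Type*} [CommRing R] [AddCommGroup K] [Module R K]
    [AddCommGroup L] [Module.Free ℤ L] (N : Submodule R K) [Module ℤ (K ⧸ N)] (g : K →+ L)
    (hg : ∀ v, g v = 0 ↔ v ∈ N) : Module.Free ℤ (K ⧸ N) := by
  let f : K ⧸ N →+ L := QuotientAddGroup.lift N.toAddSubgroup g fun v hv => (hg v).2 hv
  refine Module.Free.of_injective_of_isPrincipal
    { f with map_smul' := fun c v => map_intCast_smul f ℤ ℤ c v } ?_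
  refine (injective_iff_map_eq_zero f).2 fun ν hν => ?_
  obtain ⟨v, rfl⟩ := N.mkQ_surjective ν
  exact (Submodule.Quotient.mk_eq_zero N).2 ((hg v).1 hν)

section Top

variable (m n l : ℕ) (i : Fin l → Fin (m + 1))

/-- The central ideal of a Bott–Samelson ring, with the two actions extended to all variables. -/
lemma exists_nFree_bs (hn : n ≠ 0) : ∃ a b : ℕ → BSRing m l i,
    (∀ j : Fin (m + 2), a j = xB m l i j) ∧ (∀ j : Fin (m + 2), b j = yB m l i j) ∧
      (∀ j, m + 2 ≤ j → a j = b j) ∧ NFree a b (psumN (m + 2) (n + 1)) (n + 1) := by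
  obtain ⟨w, hw, h⟩ := exists_bsModel m l i
  set W := BObj.ops (BObj.tower (m + 2)) (BObj.rights w)
  obtain ⟨e, hx, hy⟩ := h
  have hW : BObj.Free W (psumN (m + 2) (n + 1)) (n + 1) := BObj.free_ops_tower hn _ w hw
  refine ⟨fun j => e.symm (W.x j), fun j => e.symm (W.y j), fun j => ?_, fun j => ?_,
    fun j hj => ?_, ?_⟩
  · exact e.symm_apply_eq.2 (hx j).symm
  · exact e.symm_apply_eq.2 (hy j).symm
  · refine congrArg e.symm (BObj.ops_x_eq_y _ (fun t ht => ?_) (by rw [BObj.tower_x_eq_y]))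
    obtain ⟨k, hk, rfl⟩ := List.mem_map.1 ht
    exact (hw k hk).trans_le hj
  · refine BObj.Free.of_retr (M := ⟨BSRing m l i, inferInstance, fun j => e.symm (W.x j),
      fun j => e.symm (W.y j)⟩) ⟨(e : BSRing m l i →+ W.R), (e.symm : W.R →+ BSRing m l i),
        ⟨fun j v => ?_, fun j v => ?_⟩, ⟨fun j v => ?_, fun j v => ?_⟩, e.symm_apply_apply⟩ hW
    · change e (e.symm (W.x j) * v) = W.x j * e v
      rw [map_mul, e.apply_symm_apply]
    · change e (e.symm (W.y j) * v) = W.y j * e v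
      rw [map_mul, e.apply_symm_apply]
    · exact map_mul e.symm _ _
    · exact map_mul e.symm _ _

variable {m n l i}

lemma IsKCocycle.sub_iff {ι R : Type*} [CommRing R] {a b f : ι → R} :
    IsKCocycle (fun j => a j - b j) 0 f ↔ IsKCocycle a b f := by
  simp [IsKCocycle]

lemma mem_biderIdeal_bs {a b : ℕ → BSRing m l i} (ha : ∀ j : Fin (m + 2), a j = xB m l i j)
    (hb : ∀ j : Fin (m + 2), b j = yB m l i j) (hab : ∀ j, m + 2 ≤ j → a j = b j)
    {c : Fin (m + 2) → FPoly (m + 2)}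
    (hhom : ∃ a : Fin (m + 2) → Fin (m + 2) → FQRing (m + 2),
      ∀ j : Fin (m + 2),
        toFQ (m + 2) (c j) - kappa (m + 2) n j
          = ∑ i' : Fin (m + 2), (a i' j - a j i') * (xQ (m + 2) i' - yQ (m + 2) i'))
    {v : BSRing m l i} (hv : v ∈ centralIdeal a b) :
    v ∈ biderIdeal a b (psumN (m + 2) (n + 1)) (n + 1) ↔
      ∃ f : Fin (m + 2) → BSRing m l i, IsKCocycle (fun j => xB m l i j - yB m l i j) 0 f ∧
        v = ∑ j, toBS m l i (c j) * f j := by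
  rw [mem_biderIdeal_psumN, and_iff_right hv]
  push_cast
  constructor
  · rintro ⟨f, hf, h⟩
    have hf' : IsKCocycle (fun j => xB m l i j - yB m l i j) 0 fun j : Fin (m + 2) => f j := by
      rw [IsKCocycle.sub_iff]
      intro j k
      rw [← ha, ← hb, ← ha, ← hb, hf]
    refine ⟨_, hf', bs_natCast_mul_cancel m l i (k := n) ?_⟩
    rw [succ_mul_sum_toBS_mul m n l i c hhom hf', h, Finset.sum_range]
    simp only [ha, hb]
  · rintro ⟨f, hf, rfl⟩
    refine ⟨fun j => if h : j < m + 2 then f ⟨j, h⟩ else 0, fun j k => ?_, ?_⟩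
    · rw [IsKCocycle.sub_iff] at hf
      beta_reduce
      by_cases hj : j < m + 2 <;> by_cases hk : k < m + 2
      · rw [dif_pos hj, dif_pos hk]
        have := hf ⟨j, hj⟩ ⟨k, hk⟩
        rwa [← ha, ← ha, ← hb, ← hb] at this
      · rw [dif_neg hk, hab k (not_lt.1 hk), sub_self, mul_zero, zero_mul]
      · rw [dif_neg hj, hab j (not_lt.1 hj), sub_self, mul_zero, zero_mul]
      · rw [dif_neg hk, hab k (not_lt.1 hk), sub_self, mul_zero, zero_mul]
    · rw [succ_mul_sum_toBS_mul m n l i c hhom hf, Finset.sum_range]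
      simp [ha, hb]

lemma mem_centralIdeal_bs {a b : ℕ → BSRing m l i} (ha : ∀ j : Fin (m + 2), a j = xB m l i j)
    (hb : ∀ j : Fin (m + 2), b j = yB m l i j) (hab : ∀ j, m + 2 ≤ j → a j = b j)
    {v : BSRing m l i} : v ∈ centralIdeal a b ↔ ∀ j, (xB m l i j - yB m l i j) * v = 0 := by
  simp only [sub_mul, sub_eq_zero, ← ha, ← hb]
  refine ⟨fun h j => h j, fun h j => ?_⟩
  by_cases hj : j < m + 2
  · exact h ⟨j, hj⟩
  · rw [hab j (not_lt.1 hj)]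

lemma exists_cocycle_of_central {c : Fin (m + 2) → FPoly (m + 2)}
    (hhom : ∃ a : Fin (m + 2) → Fin (m + 2) → FQRing (m + 2),
      ∀ j : Fin (m + 2),
        toFQ (m + 2) (c j) - kappa (m + 2) n j
          = ∑ i' : Fin (m + 2), (a i' j - a j i') * (xQ (m + 2) i' - yQ (m + 2) i'))
    {v : BSRing m l i} (hv : ∀ j, (xB m l i j - yB m l i j) * v = 0) (j : Fin (m + 2)) :
    ∃ f : Fin (m + 2) → BSRing m l i, IsKCocycle (fun j => xB m l i j - yB m l i j) 0 f ∧
      xB m l i j ^ n * v = ∑ j, toBS m l i (c j) * f j := by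
  have hf : IsKCocycle (fun j => xB m l i j - yB m l i j) 0 (Pi.single j v) := by
    have (k k' : Fin (m + 2)) : (Pi.single j v : Fin (m + 2) → BSRing m l i) k *
        (xB m l i k' - yB m l i k') = 0 := by
      rcases eq_or_ne k j with rfl | hk
      · rw [Pi.single_eq_same, mul_comm, hv]
      · rw [Pi.single_eq_of_ne hk, zero_mul]
    intro k k'
    simp only [Pi.zero_apply, sub_zero, this]
  refine ⟨_, hf, bs_natCast_mul_cancel m l i (k := n) ?_⟩
  rw [succ_mul_sum_toBS_mul m n l i c hhom hf, Finset.sum_eq_single j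
    (fun k _ hk => by rw [Pi.single_eq_of_ne hk, zero_mul]) (by simp), Pi.single_eq_same, mul_comm v,
    hsum_mul (sub_eq_zero.1 (by rw [← sub_mul, hv]))]

end Top

/-- Fix `r = m + 2 ≥ 2` and `n ≥ 1`.  Let `z = Σ_j c_j·x̂_j` be a
degree-1 cycle of `K(𝔉; x − y)` whose image in `K(ℚ ⊗ 𝔉; x − y)` is homologous to
`κ_n` (elements of `𝔉` are quantified via representatives `c j ∈ ℤ[x,y]`).  Let
`J = (i_1,…,i_l)` be any sequence of crossing indices and `Φ(z) = Σ_j φ_J(c_j)·x̂_j` in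
`K(R_J; x − y)`.  Then the quotient
`N = H_r / (image of multiplication by the class of Φ(z) : H_{r−1} → H_r)`
— realized as degree-`r` cycles modulo the sum of the degree-`r` boundaries and the
`Φ(z)`-multiples of degree-`(r−1)` cycles — is a free abelian group, and
`x_j^n · N = 0` for every `j`, i.e. the `ℤ[x_1,…,x_r]`-module structure on `N` factors
through `ℤ[x_1,…,x_r]/(x_1^n,…,x_r^n)`. -/
theorem stmt11 (m n l : ℕ) (hn : 1 ≤ n) (i : Fin l → Fin (m + 1))
    (c : Fin (m + 2) → FPoly (m + 2))
    (hcycle :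
      ∑ j : Fin (m + 2), Ideal.Quotient.mk _ (c j) * (xZ (m + 2) j - yZ (m + 2) j) = 0)
    (hhom : ∃ a : Fin (m + 2) → Fin (m + 2) → FQRing (m + 2),
      ∀ j : Fin (m + 2),
        toFQ (m + 2) (c j) - kappa (m + 2) n j
          = ∑ i' : Fin (m + 2), (a i' j - a j i') * (xQ (m + 2) i' - yQ (m + 2) i')) :
    let z : Fin (m + 2) → BSRing m l i := fun j => xB m l i j - yB m l i j
    let Φ : Fin (m + 2) → BSRing m l i := fun j => toBS m l i (c j)
    let Bd : Submodule (BSRing m l i) (kcycles z (m + 2)) :=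
      ((kbdries z (m + 2)) ⊔ Submodule.map (extMul Φ)
          (kcycles z ((m + 2 : ℤ) - 1))).comap (kcycles z (m + 2)).subtype
    Module.Free ℤ (kcycles z (m + 2) ⧸ Bd) ∧
      ∀ (j : Fin (m + 2)) (ν : kcycles z (m + 2) ⧸ Bd), (xB m l i j) ^ n • ν = 0 := by
  intro z Φ Bd
  obtain ⟨a, b, ha, hb, hab, L, _, _, g, hg⟩ := exists_nFree_bs m n l i (by lia)
  have htop {f : KModule (BSRing m l i) (m + 2)} : f ∈ kcycles z (m + 2) ↔
      (∀ s, s ≠ Finset.univ → f s = 0) ∧ ∀ j, z j * f Finset.univ = 0 := by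
    rw [← mem_kcycles_top]
    push_cast
    rfl
  have hcen {v : BSRing m l i} : v ∈ centralIdeal a b ↔ ∀ j, z j * v = 0 :=
    mem_centralIdeal_bs ha hb hab
  have hBd (f : kcycles z (m + 2)) : f ∈ Bd ↔
      ∃ φ, IsKCocycle z 0 φ ∧ f.1 Finset.univ = ∑ j, Φ j * φ j := by
    have h := mem_kbdries_sup_map_extMul (z := z) (c := Φ) (mem_kdeg_top.2 (htop.1 f.2).1)
    push_cast at h
    exact h
  let θ : kcycles z (m + 2) →+ centralIdeal a b :=
    { toFun f := ⟨f.1 Finset.univ, hcen.2 (htop.1 f.2).2⟩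
      map_zero' := rfl
      map_add' _ _ := rfl }
  have hθ (f : kcycles z (m + 2)) : g (θ f) = 0 ↔ f ∈ Bd := by
    rw [hg, mem_biderIdeal_bs ha hb hab hhom (θ f).2, hBd]
    rfl
  refine ⟨Bd.free_int_quotient (g.comp θ) hθ, fun j ν => ?_⟩
  obtain ⟨f, rfl⟩ := Bd.mkQ_surjective ν
  rw [← map_smul]
  refine (Submodule.Quotient.mk_eq_zero Bd).2 ((hBd _).2 ?_)
  exact exists_cocycle_of_central hhom (htop.1 f.2).2 j
end
end

section
/- Let r ≥ 2 and let J = (i_1, …, i_l) be a sequence with each i_t ∈ {1, …, r−1}, l ≥ 2, and i_{l−1} = i_l. Set J' := (i_1, …, i_{l−1}). The assignment x_i ↦ x_i, δ_t ↦ δ_t for t ≤ l−2, and δ_{l−1} ↦ δ_{l−1} + δ_l determines a well-defined ring homomorphism R_{J'} → R_J, and via this homomorphism R_J is a free R_{J'}-module with basis {1, δ_l}. -/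
noncomputable section
open MvPolynomial

namespace BottSamelson

variable {m n l : ℕ} {S T : Type*} [CommRing S] [CommRing T]

/-- The linear form `x_{i_t} − x_{i_t+1} + 2·Σ_{s<t, i_s=i_t} d_s − Σ_{s<t, |i_s−i_t|=1} d_s`
evaluated in a commutative ring; the `t`-th relation says `d_t·(d_t + linForm t) = 0`. -/
def linForm (i : Fin l → Fin (m + 1)) (x : Fin (m + 2) → S) (d : Fin l → S) (t : Fin l) : S :=
  x (i t).castSucc - x (i t).succ
    + 2 * ∑ s ∈ Finset.univ.filter fun s => s < t ∧ i s = i t, d s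
    - ∑ s ∈ Finset.univ.filter
        fun s => s < t ∧ ((i s : ℕ) = (i t : ℕ) + 1 ∨ (i t : ℕ) = (i s : ℕ) + 1), d s

/-- The elements `x_j`, `d_t` of a commutative ring satisfy the Bott–Samelson relations. -/
def Satisfies (i : Fin l → Fin (m + 1)) (x : Fin (m + 2) → S) (d : Fin l → S) : Prop :=
  ∀ t, d t * (d t + linForm i x d t) = 0

theorem linForm_congr (i : Fin l → Fin (m + 1)) (x : Fin (m + 2) → S) {d d' : Fin l → S}
    {t : Fin l} (h : ∀ s < t, d s = d' s) : linForm i x d t = linForm i x d' t := by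
  unfold linForm
  congr 1
  · congr 2
    exact Finset.sum_congr rfl fun s hs => h s (Finset.mem_filter.mp hs).2.1
  · exact Finset.sum_congr rfl fun s hs => h s (Finset.mem_filter.mp hs).2.1

theorem linForm_castSucc (i : Fin (l + 1) → Fin (m + 1)) (x : Fin (m + 2) → S)
    (d : Fin (l + 1) → S) (t : Fin l) :
    linForm i x d t.castSucc =
      linForm (fun s => i s.castSucc) x (fun s => d s.castSucc) t := by
  simp [linForm, Finset.sum_filter, Fin.sum_univ_castSucc, Fin.not_lt.mpr (Fin.le_last _)]

theorem linForm_last (i : Fin (n + 2) → Fin (m + 1))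
    (hlast : i (Fin.last n).castSucc = i (Fin.last (n + 1)))
    (x : Fin (m + 2) → S) (d : Fin (n + 2) → S) :
    linForm i x d (Fin.last (n + 1)) =
      linForm (fun s => i s.castSucc) x (fun s => d s.castSucc) (Fin.last n)
        + 2 * d (Fin.last n).castSucc := by
  simp [linForm, Finset.sum_filter, Fin.sum_univ_castSucc, ← hlast, Fin.castSucc_lt_last]
  ring

theorem map_linForm (f : S →+* T) (i : Fin l → Fin (m + 1)) (x : Fin (m + 2) → S)
    (d : Fin l → S) (t : Fin l) :
    f (linForm i x d t) = linForm i (fun j => f (x j)) (fun s => f (d s)) t := by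
  simp [linForm, map_ofNat f 2]

theorem Satisfies.map (f : S →+* T) {i : Fin l → Fin (m + 1)} {x : Fin (m + 2) → S}
    {d : Fin l → S} (h : Satisfies i x d) :
    Satisfies i (fun j => f (x j)) (fun s => f (d s)) := fun t => by
  rw [← map_linForm, ← map_add, ← map_mul, h t, map_zero]

theorem aeval_BSrel (i : Fin l → Fin (m + 1)) (x : Fin (m + 2) → S) (d : Fin l → S)
    (t : Fin l) :
    aeval (Sum.elim x d) (BSrel m l i t) = d t * (d t + linForm i x d t) := by
  simp [BSrel, linForm]
  ring

theorem satisfies_δB (i : Fin l → Fin (m + 1)) : Satisfies i (xB m l i) (δB m l i) := fun t => by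
  have h : (aeval (Sum.elim (xB m l i) (δB m l i)) : BSPoly m l →ₐ[ℤ] BSRing m l i).toRingHom =
      Ideal.Quotient.mk (Ideal.span (Set.range (BSrel m l i))) :=
    MvPolynomial.ringHom_ext (fun r => by simp) (by rintro (j | s) <;> simp [xB, δB])
  rw [← aeval_BSrel]
  exact (RingHom.congr_fun h _).trans
    (Ideal.Quotient.eq_zero_iff_mem.mpr (Ideal.subset_span ⟨t, rfl⟩))

/-- The ring homomorphism out of `R_J` determined by elements satisfying its relations. -/
def lift (i : Fin l → Fin (m + 1)) (x : Fin (m + 2) → S) (d : Fin l → S)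
    (h : Satisfies i x d) : BSRing m l i →+* S :=
  Ideal.Quotient.lift _ (aeval (Sum.elim x d) : BSPoly m l →ₐ[ℤ] S).toRingHom fun p hp => by
    have hle : Ideal.span (Set.range (BSrel m l i)) ≤
        RingHom.ker (aeval (Sum.elim x d) : BSPoly m l →ₐ[ℤ] S).toRingHom := by
      rw [Ideal.span_le]
      rintro _ ⟨t, rfl⟩
      exact (aeval_BSrel i x d t).trans (h t)
    exact hle hp

theorem lift_mk (i : Fin l → Fin (m + 1)) (x : Fin (m + 2) → S) (d : Fin l → S)
    (h : Satisfies i x d) (p : BSPoly m l) :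
    lift i x d h (Ideal.Quotient.mk _ p) = aeval (Sum.elim x d) p := rfl

@[simp]
theorem lift_xB (i : Fin l → Fin (m + 1)) (x : Fin (m + 2) → S) (d : Fin l → S)
    (h : Satisfies i x d) (j : Fin (m + 2)) : lift i x d h (xB m l i j) = x j := by
  simp [xB, lift_mk]

@[simp]
theorem lift_δB (i : Fin l → Fin (m + 1)) (x : Fin (m + 2) → S) (d : Fin l → S)
    (h : Satisfies i x d) (t : Fin l) : lift i x d h (δB m l i t) = d t := by
  simp [δB, lift_mk]

theorem hom_ext {i : Fin l → Fin (m + 1)} {f g : BSRing m l i →+* S}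
    (hx : ∀ j, f (xB m l i j) = g (xB m l i j)) (hδ : ∀ t, f (δB m l i t) = g (δB m l i t)) :
    f = g := by
  refine Ideal.Quotient.ringHom_ext (MvPolynomial.ringHom_ext (fun r => ?_) ?_)
  · simp
  · rintro (j | t)
    exacts [hx j, hδ t]

/-- Replacing the last two elements `u, w` by `u + w` preserves the relations when the last two
crossings agree. -/
theorem Satisfies.merge {i : Fin (n + 2) → Fin (m + 1)}
    (hlast : i (Fin.last n).castSucc = i (Fin.last (n + 1)))
    {x : Fin (m + 2) → S} {d : Fin (n + 2) → S} (h : Satisfies i x d) :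
    Satisfies (fun t => i t.castSucc) x
      (Function.update (fun t => d t.castSucc) (Fin.last n)
        (d (Fin.last n).castSucc + d (Fin.last (n + 1)))) := fun t => by
  rw [linForm_congr _ x (d' := fun t => d t.castSucc) fun s hs =>
    Function.update_of_ne (hs.trans_le (Fin.le_last t)).ne _ _]
  have ht := h t.castSucc
  rw [linForm_castSucc] at ht
  by_cases hn : t = Fin.last n
  · subst hn
    have hw := h (Fin.last (n + 1))
    rw [linForm_last i hlast] at hw
    rw [Function.update_self]
    linear_combination ht + hw
  · rwa [Function.update_of_ne hn]

/-- Splitting the last element `s` as `(s − w) + w` preserves the relations when the last two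
crossings agree and `w` satisfies the appropriate quadratic equation. -/
theorem Satisfies.split {i : Fin (n + 2) → Fin (m + 1)}
    (hlast : i (Fin.last n).castSucc = i (Fin.last (n + 1)))
    {x : Fin (m + 2) → S} {d : Fin (n + 1) → S} (h : Satisfies (fun t => i t.castSucc) x d)
    {w : S} (hw : w * w =
      (linForm (fun t => i t.castSucc) x d (Fin.last n) + 2 * d (Fin.last n)) * w) :
    Satisfies i x (Fin.snoc (α := fun _ => S)
      (Function.update d (Fin.last n) (d (Fin.last n) - w)) w) := by
  have hd (t : Fin (n + 1)) : linForm (fun t => i t.castSucc) x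
      (Function.update d (Fin.last n) (d (Fin.last n) - w)) t =
        linForm (fun t => i t.castSucc) x d t :=
    linForm_congr _ x fun s hs => Function.update_of_ne (hs.trans_le (Fin.le_last t)).ne _ _
  refine Fin.lastCases ?_ fun t => ?_
  · rw [linForm_last i hlast]
    simp only [Fin.snoc_castSucc, Fin.snoc_last, Function.update_self, hd]
    linear_combination -hw
  · rw [linForm_castSucc]
    simp only [Fin.snoc_castSucc, hd]
    have ht := h t
    by_cases hn : t = Fin.last n
    · subst hn
      rw [Function.update_self]
      linear_combination ht + hw
    · rwa [Function.update_of_ne hn]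

/-- A ring identified with a quadratic algebra over `S` is free over `S` with basis `{1, w}`. -/
theorem existsUnique_add_mul_of_quadraticAlgebra (h : S →+* T) {w : T} {a b : S}
    (hw : w * w = h a + h b * w) (g : T →+* QuadraticAlgebra S a b)
    (hgh : ∀ c, g (h c) = algebraMap S _ c) (hgw : g w = QuadraticAlgebra.omega)
    (hg : ∀ k : QuadraticAlgebra S a b →+* T, (∀ c, k (algebraMap S _ c) = h c) →
      k QuadraticAlgebra.omega = w → ∀ v, k (g v) = v) (v : T) :
    ∃! c : S × S, v = h c.1 + h c.2 * w := by
  have key (c : S × S) : g (h c.1 + h c.2 * w) = ⟨c.1, c.2⟩ := by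
    rw [map_add, map_mul, hgh, hgh, hgw]
    ext <;> simp
  let := h.toAlgebra
  let k : QuadraticAlgebra S a b →ₐ[S] T := QuadraticAlgebra.lift
    ⟨w, by rw [hw, Algebra.smul_def, Algebra.smul_def, mul_one]; rfl⟩
  have hk (q : QuadraticAlgebra S a b) : k q = h q.re + h q.im * w := by
    simp [k, QuadraticAlgebra.lift, Algebra.smul_def, RingHom.algebraMap_toAlgebra]
  refine ⟨((g v).re, (g v).im), ?_, fun c hc => ?_⟩
  · exact (hg k.toRingHom (fun c => by simp [hk]) (by simp [hk]) v).symm.trans (hk _)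
  · rw [hc, key]

end BottSamelson

/-- Let `r = m + 2 ≥ 2` and let `J = (i_1,…,i_l)` with `l = n + 2 ≥ 2`
and `i_{l−1} = i_l` (zero-based positions `n` and `n+1`).  Let `J' = (i_1,…,i_{l−1})`.
The assignment `x_j ↦ x_j`, `δ_t ↦ δ_t` for `t ≤ l−2`, `δ_{l−1} ↦ δ_{l−1} + δ_l`
determines a well-defined ring homomorphism `h : R_{J'} → R_J`, and via `h` the ring
`R_J` is a free `R_{J'}`-module with basis `{1, δ_l}`, i.e. every element of `R_J` is
uniquely `h(c₁) + h(c₂)·δ_l`. -/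
theorem stmt12 (m n : ℕ) (i : Fin (n + 2) → Fin (m + 1))
    (hlast : i ⟨n, by omega⟩ = i ⟨n + 1, by omega⟩) :
    ∃ h : BSRing m (n + 1) (fun t => i t.castSucc) →+* BSRing m (n + 2) i,
      (∀ p : BSPoly m (n + 1),
          h (Ideal.Quotient.mk _ p) =
            MvPolynomial.aeval
              (Sum.elim (xB m (n + 2) i)
                (fun t : Fin (n + 1) =>
                  if (t : ℕ) = n then
                    δB m (n + 2) i ⟨n, by omega⟩ + δB m (n + 2) i ⟨n + 1, by omega⟩
                  else δB m (n + 2) i t.castSucc)) p) ∧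
      ∀ v : BSRing m (n + 2) i,
        ∃! c : BSRing m (n + 1) (fun t => i t.castSucc) × BSRing m (n + 1) (fun t => i t.castSucc),
          v = h c.1 + h c.2 * δB m (n + 2) i ⟨n + 1, by omega⟩ := by
  have hlast' : i (Fin.last n).castSucc = i (Fin.last (n + 1)) := hlast
  have hs := (BottSamelson.satisfies_δB i).merge hlast'
  have hs' := BottSamelson.satisfies_δB (m := m) (fun t : Fin (n + 1) => i t.castSucc)
  let h := BottSamelson.lift _ _ _ hs
  have hupd : Function.update (fun t : Fin (n + 1) => δB m (n + 2) i t.castSucc) (Fin.last n)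
      (δB m (n + 2) i (Fin.last n).castSucc + δB m (n + 2) i (Fin.last (n + 1))) =
        fun t : Fin (n + 1) => if (t : ℕ) = n then
          δB m (n + 2) i ⟨n, by omega⟩ + δB m (n + 2) i ⟨n + 1, by omega⟩
        else δB m (n + 2) i t.castSucc := by
    funext t
    simp only [Function.update_apply, Fin.ext_iff, Fin.val_last]
    rfl
  refine ⟨h, fun p => ?_, ?_⟩
  · rw [← hupd]
    exact BottSamelson.lift_mk _ _ _ hs p
  let b := BottSamelson.linForm (fun t => i t.castSucc) (xB m (n + 1) fun t => i t.castSucc)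
      (δB m (n + 1) fun t => i t.castSucc) (Fin.last n)
    + 2 * δB m (n + 1) (fun t => i t.castSucc) (Fin.last n)
  let C := algebraMap (BSRing m (n + 1) fun t => i t.castSucc) (QuadraticAlgebra _ 0 b)
  have hω : (QuadraticAlgebra.omega : QuadraticAlgebra _ 0 b) * QuadraticAlgebra.omega =
      C b * QuadraticAlgebra.omega := by
    ext <;> simp [C]
  have hq := (hs'.map C).split hlast' (w := QuadraticAlgebra.omega) (by
    rw [hω, ← BottSamelson.map_linForm, map_add, map_mul, map_ofNat])
  let g := BottSamelson.lift _ _ _ hq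
  have hb : h b = BottSamelson.linForm (fun t => i t.castSucc) (xB m (n + 2) i)
      (fun t => δB m (n + 2) i t.castSucc) (Fin.last n)
      + 2 * (δB m (n + 2) i (Fin.last n).castSucc + δB m (n + 2) i (Fin.last (n + 1))) := by
    simp only [b, h, map_add, map_mul, map_ofNat, BottSamelson.map_linForm, BottSamelson.lift_xB,
      BottSamelson.lift_δB, Function.update_self]
    rw [BottSamelson.linForm_congr _ _ fun s hs => Function.update_of_ne hs.ne _ _]
  refine BottSamelson.existsUnique_add_mul_of_quadraticAlgebra h (a := 0) (b := b) ?_ g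
    (fun c => ?_) ?_ fun k hk hkω v => ?_
  · have hw := BottSamelson.satisfies_δB i (Fin.last (n + 1))
    rw [BottSamelson.linForm_last i hlast'] at hw
    rw [hb, map_zero]
    change δB m (n + 2) i (Fin.last (n + 1)) * δB m (n + 2) i (Fin.last (n + 1)) =
      0 + _ * δB m (n + 2) i (Fin.last (n + 1))
    linear_combination -hw
  · refine RingHom.congr_fun (f := g.comp h) (g := C) (BottSamelson.hom_ext (fun j => ?_)
      fun t => ?_) c
    · simp [g, h]
    · by_cases ht : t = Fin.last n
      · subst ht
        simp [g, h, -Fin.snoc_update]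
      · simp [g, h, -Fin.snoc_update, Function.update_of_ne ht]
  · exact (BottSamelson.lift_δB _ _ _ hq (Fin.last (n + 1))).trans (Fin.snoc_last _ _)
  · refine RingHom.congr_fun (f := k.comp g) (g := RingHom.id _) (BottSamelson.hom_ext
      (fun j => ?_) (Fin.lastCases ?_ fun t => ?_)) v
    · simp [g, C, hk, h]
    · simp only [RingHom.comp_apply, g, BottSamelson.lift_δB, Fin.snoc_last]
      exact hkω
    · by_cases ht : t = Fin.last n
      · subst ht
        simp only [RingHom.comp_apply, g, BottSamelson.lift_δB, Fin.snoc_castSucc,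
          Function.update_self, map_sub, C, hk, hkω, h, RingHom.id_apply]
        exact add_sub_cancel_right _ _
      · simp [g, C, hk, h, -Fin.snoc_update, Function.update_of_ne ht]
end
end
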